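/- arXiv:1002.2674 — 2 statements merged into one kernel-verified Lean document; each statement's English description precedes it below -/
import Mathlib

section
/- Let θ ∈ k^× have finite order m. Then the cyclic algebra (t_1, t_2; m, K_2, θ) is a central simple algebra over K_2 whose class in the Brauer group Br(K_2) has order exactly m. -/
noncomputable section

/-- `K_2 = k(t_1, t_2)`, the field of rational functions in two variables over `k`. -/
abbrev KTwo (k : Type*) [Field k] : Type _ := FractionRing (MvPolynomial (Fin 2) k)

/-- The images `t_1, t_2` of the two variables in `K_2`. -/
def tv (k : Type*) [Field k] (i : Fin 2) : KTwo k :=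
  algebraMap (MvPolynomial (Fin 2) k) (KTwo k) (MvPolynomial.X i)

/-- The defining relations of the cyclic algebra `(u_1, u_2; m, K_2, θ)`:
`y_1 y_2 = θ y_2 y_1`, `y_1^m = u_1` and `y_2^m = u_2`, where `y_1, y_2` are the images
of the indices `0, 1`. -/
inductive CycRel (k : Type*) [Field k] (m : ℕ) (θ : k) (u₁ u₂ : KTwo k) :
    FreeAlgebra (KTwo k) (Fin 2) → FreeAlgebra (KTwo k) (Fin 2) → Prop
  | q_comm : CycRel k m θ u₁ u₂
      (FreeAlgebra.ι (KTwo k) 0 * FreeAlgebra.ι (KTwo k) 1)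
      (algebraMap (KTwo k) (FreeAlgebra (KTwo k) (Fin 2)) (algebraMap k (KTwo k) θ) *
        (FreeAlgebra.ι (KTwo k) 1 * FreeAlgebra.ι (KTwo k) 0))
  | pow_one : CycRel k m θ u₁ u₂ (FreeAlgebra.ι (KTwo k) 0 ^ m)
      (algebraMap (KTwo k) (FreeAlgebra (KTwo k) (Fin 2)) u₁)
  | pow_two : CycRel k m θ u₁ u₂ (FreeAlgebra.ι (KTwo k) 1 ^ m)
      (algebraMap (KTwo k) (FreeAlgebra (KTwo k) (Fin 2)) u₂)

/-- The cyclic algebra `(u_1, u_2; m, K_2, θ)`. -/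
abbrev CyclicAlg (k : Type*) [Field k] (m : ℕ) (θ : k) (u₁ u₂ : KTwo k) : Type _ :=
  RingQuot (CycRel k m θ u₁ u₂)

open scoped TensorProduct in
/-- A finite tensor power `A^{⊗ r}` over `K_2` is *split* if it is isomorphic to a matrix
algebra over `K_2`; for a central simple algebra `A`, the class `[A]` in the Brauer group
`Br(K_2)` has order exactly `m` iff `A^{⊗ m}` is split and no smaller positive tensor
power is. -/
def TensorPowSplit (k : Type*) [Field k] (A : Type*) [Ring A] [Algebra (KTwo k) A]
    (r : ℕ) : Prop :=
  ∃ n : ℕ, 0 < n ∧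
    Nonempty ((⨂[KTwo k] _ : Fin r, A) ≃ₐ[KTwo k] Matrix (Fin n) (Fin n) (KTwo k))

open scoped TensorProduct
open Module

section QuantumTorus

/-- If a sum of simultaneous eigenvectors for conjugation by the units `Y p`, with distinct
systems of eigenvalues, lies in a subspace stable under these conjugations, then so does each
summand. -/
theorem eigenvector_mem_of_sum_mem {K B X P : Type*} [Field K] [Ring B] [Algebra K B]
    [DecidableEq X] (Y : P → Bˣ) (χ : P → X → K) (hsep : ∀ x y, (∀ p, χ p x = χ p y) → x = y)
    (I : Submodule K B) (hl : ∀ p, ∀ b ∈ I, (Y p : B) * b ∈ I)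
    (hr : ∀ p, ∀ b ∈ I, b * ((Y p)⁻¹ : Bˣ) ∈ I) (S : Finset X) (b : X → B)
    (hb : ∀ p x, (Y p : B) * b x = χ p x • (b x * Y p)) (hS : ∑ x ∈ S, b x ∈ I) :
    ∀ x ∈ S, b x ∈ I := by
  have hconj : ∀ p x, (Y p : B) * b x * ((Y p)⁻¹ : Bˣ) = χ p x • b x := by
    intro p x
    rw [hb, smul_mul_assoc, mul_assoc, Units.mul_inv, mul_one]
  induction S using Finset.induction_on generalizing b with
  | empty => simp
  | insert x₀ S hx₀ ih =>
    have key : ∀ x ∈ S, b x ∈ I := by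
      intro x hx
      obtain ⟨p, hp⟩ : ∃ p, χ p x ≠ χ p x₀ := by
        by_contra! h
        exact hx₀ (hsep _ _ h ▸ hx)
      have h := ih (fun x => (χ p x - χ p x₀) • b x)
        (fun q x => by rw [mul_smul_comm, hb, smul_mul_assoc, smul_comm]) ?_
        (fun q x => by rw [mul_smul_comm, smul_mul_assoc, hconj, smul_comm]) x hx
      · exact (I.smul_mem_iff (sub_ne_zero.mpr hp)).mp h
      · have h1 := I.sub_mem (hr p _ (hl p _ hS)) (I.smul_mem (χ p x₀) hS)
        rw [Finset.mul_sum, Finset.sum_mul, Finset.smul_sum, ← Finset.sum_sub_distrib,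
          Finset.sum_insert hx₀] at h1
        simpa [hconj, sub_smul] using h1
    intro x hx
    rcases Finset.mem_insert.mp hx with rfl | hx
    · rw [Finset.sum_insert hx₀] at hS
      exact (I.add_mem_iff_left (I.sum_mem key)).mp hS
    · exact key x hx

variable {K B X P : Type*} [Field K] [Ring B] [Algebra K B]
  (M : X → Bˣ) (Y : P → Bˣ) (χ : P → X → K)

theorem linearIndependent_eigenunits [Nontrivial B]
    (hsep : ∀ x y, (∀ p, χ p x = χ p y) → x = y)
    (hM : ∀ p x, (Y p : B) * M x = χ p x • ((M x : B) * Y p)) :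
    LinearIndependent K (fun x => (M x : B)) := by
  classical
  rw [linearIndependent_iff']
  intro S g hg x hx
  have h := eigenvector_mem_of_sum_mem Y χ hsep (⊥ : Submodule K B)
    (by simp) (by simp) S (fun x => g x • (M x : B))
    (fun p x => by rw [mul_smul_comm, hM, smul_mul_assoc, smul_comm]) (by simpa using hg) x hx
  simpa using h

theorem isSimpleRing_of_eigenunits [Nontrivial B]
    (hsep : ∀ x y, (∀ p, χ p x = χ p y) → x = y)
    (hM : ∀ p x, (Y p : B) * M x = χ p x • ((M x : B) * Y p))
    (hspan : Submodule.span K (Set.range fun x => (M x : B)) = ⊤) : IsSimpleRing B := by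
  classical
  refine IsSimpleRing.of_eq_bot_or_eq_top fun I => or_iff_not_imp_left.mpr fun hI => ?_
  obtain ⟨b, hbI, hb0⟩ : ∃ b ∈ I, b ≠ 0 := by
    by_contra! h
    exact hI (eq_bot_iff.mpr fun b hb => (TwoSidedIdeal.mem_bot B).mpr (h b hb))
  let I' : Submodule K B :=
    { carrier := I
      add_mem' := fun ha hb => I.add_mem ha hb
      zero_mem' := I.zero_mem
      smul_mem' := fun c x hx => by
        rw [Algebra.smul_def]
        exact I.mul_mem_left _ _ hx }
  obtain ⟨f, hf⟩ : b ∈ LinearMap.range (Finsupp.linearCombination K fun x => (M x : B)) := by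
    rw [Finsupp.range_linearCombination, hspan]
    trivial
  rw [Finsupp.linearCombination_apply, Finsupp.sum] at hf
  have h := eigenvector_mem_of_sum_mem Y χ hsep I'
    (fun p b hb => I.mul_mem_left _ _ hb) (fun p b hb => I.mul_mem_right _ _ hb) f.support
    (fun x => f x • (M x : B))
    (fun p x => by rw [mul_smul_comm, hM, smul_mul_assoc, smul_comm])
    (by rw [hf]; exact hbI)
  obtain ⟨x, hx⟩ : f.support.Nonempty := by
    rw [Finset.nonempty_iff_ne_empty]
    rintro h0
    exact hb0 (by rw [← hf, h0, Finset.sum_empty])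
  have hx' : (M x : B) ∈ I := (I'.smul_mem_iff (Finsupp.mem_support_iff.mp hx)).mp (h x hx)
  refine (TwoSidedIdeal.one_mem_iff I).mp ?_
  simpa using I.mul_mem_left ((M x)⁻¹ : Bˣ) _ hx'

theorem isCentral_of_eigenunits [Nontrivial B]
    (hsep : ∀ x y, (∀ p, χ p x = χ p y) → x = y)
    (hM : ∀ p x, (Y p : B) * M x = χ p x • ((M x : B) * Y p))
    (hspan : Submodule.span K (Set.range fun x => (M x : B)) = ⊤) (x₀ : X) (hx₀ : M x₀ = 1) :
    Algebra.IsCentral K B := by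
  refine ⟨fun z hz => ?_⟩
  rw [Subalgebra.mem_center_iff] at hz
  obtain ⟨f, hf⟩ : z ∈ LinearMap.range (Finsupp.linearCombination K fun x => (M x : B)) := by
    rw [Finsupp.range_linearCombination, hspan]
    trivial
  rw [Finsupp.linearCombination_apply, Finsupp.sum] at hf
  have hχ₀ : ∀ p, χ p x₀ = 1 := by
    intro p
    have h := hM p x₀
    rw [hx₀, Units.val_one, mul_one, one_mul] at h
    have h2 := congrArg (· * (((Y p)⁻¹ : Bˣ) : B)) h
    simp only [smul_mul_assoc, Units.mul_inv] at h2
    rw [← Algebra.algebraMap_eq_smul_one, ← map_one (algebraMap K B)] at h2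
    exact ((algebraMap K B).injective h2).symm
  have hsupp : ∀ x ∈ f.support, x = x₀ := by
    intro x hx
    refine hsep _ _ fun p => ?_
    rw [hχ₀]
    have h := hz (Y p)
    rw [← hf, Finset.mul_sum, Finset.sum_mul, ← sub_eq_zero, ← Finset.sum_sub_distrib] at h
    have h2 : (∑ x ∈ f.support, ((χ p x - 1) * f x) • (M x : B)) * (Y p : B) = 0 := by
      rw [← h, Finset.sum_mul]
      refine Finset.sum_congr rfl fun x _ => ?_
      rw [mul_smul_comm, hM, smul_mul_assoc, mul_comm, mul_smul, sub_smul, one_smul, smul_sub,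
        smul_mul_assoc]
    rw [Units.mul_left_eq_zero] at h2
    have h3 := linearIndependent_iff'.mp (linearIndependent_eigenunits M Y χ hsep hM) _ _ h2 x hx
    exact sub_eq_zero.mp ((mul_eq_zero.mp h3).resolve_right (Finsupp.mem_support_iff.mp hx))
  refine ⟨∑ x ∈ f.support, f x, ?_⟩
  rw [← hf]
  change algebraMap K B _ = _
  rw [Algebra.algebraMap_eq_smul_one, Finset.sum_smul]
  exact Finset.sum_congr rfl fun x hx => by rw [hsupp x hx, hx₀, Units.val_one]

end QuantumTorus

section FixedSpace

variable {K V : Type*} [Field K] [CharZero K] [AddCommGroup V] [Module K V]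
  [FiniteDimensional K V]

theorem pow_mul_eq_smul_mul_pow {R B : Type*} [CommSemiring R] [Semiring B] [Algebra R B]
    {a b : B} {ζ : R} (h : a * b = ζ • (b * a)) (n : ℕ) : a ^ n * b = ζ ^ n • (b * a ^ n) := by
  induction n with
  | zero => simp
  | succ n ih =>
    rw [pow_succ, mul_assoc, h, mul_smul_comm, ← mul_assoc, ih, smul_mul_assoc, smul_smul,
      mul_assoc, pow_succ, mul_comm]

/-- If `a ^ m = 1` and `a` commutes with the automorphism `b` up to a primitive `m`-th root of
unity, then the fixed space of `a` has codimension ratio `m`. -/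
theorem finrank_ker_sub_one_mul {m : ℕ} (hm : 0 < m) {a b : End K V} {ζ : K}
    (hζ : IsPrimitiveRoot ζ m) (hb : Function.Injective b) (ham : a ^ m = 1)
    (hab : a * b = ζ • (b * a)) : finrank K (LinearMap.ker (a - 1)) * m = finrank K V := by
  have hm0 : (m : K) ≠ 0 := Nat.cast_ne_zero.mpr hm.ne'
  obtain ⟨b, rfl⟩ := (LinearMap.isUnit_iff_ker_eq_bot b).mpr (LinearMap.ker_eq_bot.mpr hb)
  have htr : ∀ j ∈ Finset.range m, j ≠ 0 → LinearMap.trace K V (a ^ j) = 0 := by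
    intro j hj hj0
    have h1 : (a ^ j) = ζ ^ j • ((b : End K V) * (a ^ j * ((b⁻¹ : (End K V)ˣ) : End K V))) := by
      rw [← mul_assoc, ← smul_mul_assoc, ← pow_mul_eq_smul_mul_pow hab, mul_assoc, Units.mul_inv,
        mul_one]
    have h2 : LinearMap.trace K V (a ^ j) = ζ ^ j * LinearMap.trace K V (a ^ j) := by
      conv_lhs => rw [h1]
      rw [map_smul, LinearMap.trace_mul_comm, mul_assoc, Units.inv_mul, mul_one, smul_eq_mul]
    have h3 : ζ ^ j ≠ 1 := hζ.pow_ne_one_of_pos_of_lt hj0 (Finset.mem_range.mp hj)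
    have h4 : (1 - ζ ^ j) * LinearMap.trace K V (a ^ j) = 0 := by rw [sub_mul, one_mul, ← h2, sub_self]
    exact (mul_eq_zero.mp h4).resolve_left (sub_ne_zero.mpr h3.symm)
  set e : End K V := (m : K)⁻¹ • ∑ j ∈ Finset.range m, a ^ j with he
  have hae : (a - 1) * e = 0 := by
    rw [he, mul_smul_comm, mul_geom_sum, ham, sub_self, smul_zero]
  have hproj : LinearMap.IsProj (LinearMap.ker (a - 1)) e := by
    refine ⟨fun x => ?_, fun x hx => ?_⟩
    · rw [LinearMap.mem_ker]
      exact LinearMap.congr_fun hae x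
    · have hx' : a x = x := by simpa [sub_eq_zero] using hx
      have hpow : ∀ j : ℕ, (a ^ j) x = x := by
        intro j
        induction j with
        | zero => simp
        | succ j ih => rw [pow_succ, Module.End.mul_apply, hx', ih]
      simp [he, LinearMap.sum_apply, hpow, ← Nat.cast_smul_eq_nsmul K, smul_smul, hm0]
  have h5 := hproj.trace
  rw [he, map_smul, map_sum, Finset.sum_eq_single_of_mem 0 (Finset.mem_range.mpr hm) htr, pow_zero,
    LinearMap.trace_one, smul_eq_mul] at h5
  have h6 : (finrank K (LinearMap.ker (a - 1)) * m : K) = finrank K V := by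
    rw [← h5]
    field_simp
  exact_mod_cast h6

theorem finrank_iInf_ker_sub_one_mul {ι : Type*} [DecidableEq ι] {m : ℕ} (hm : 0 < m)
    (c d : ι → End K V) (ζ : ι → K) (hζ : ∀ i, IsPrimitiveRoot (ζ i) m)
    (hd : ∀ i, Function.Injective (d i)) (hcm : ∀ i, c i ^ m = 1)
    (hcc : ∀ i j, Commute (c i) (c j)) (hcd : ∀ i, c i * d i = ζ i • (d i * c i))
    (hcd' : ∀ i j, i ≠ j → Commute (c i) (d j)) (S : Finset ι) :
    finrank K (⨅ i ∈ S, LinearMap.ker (c i - 1) : Submodule K V) * m ^ S.card = finrank K V := by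
  induction S using Finset.induction_on with
  | empty =>
    have h : (⨅ i ∈ (∅ : Finset ι), LinearMap.ker (c i - 1) : Submodule K V) = ⊤ := by simp
    rw [h, finrank_top, Finset.card_empty, pow_zero, mul_one]
  | insert i S hi ih =>
    set W : Submodule K V := ⨅ j ∈ S, LinearMap.ker (c j - 1) with hW
    have hmem : ∀ x, x ∈ W ↔ ∀ j ∈ S, c j x = x := by
      intro x
      simp [hW, Submodule.mem_iInf, sub_eq_zero]
    have hcW : ∀ x ∈ W, c i x ∈ W := by
      intro x hx
      rw [hmem] at hx ⊢
      intro j hj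
      rw [← Module.End.mul_apply, (hcc j i).eq, Module.End.mul_apply, hx j hj]
    have hdW : ∀ x ∈ W, d i x ∈ W := by
      intro x hx
      rw [hmem] at hx ⊢
      intro j hj
      rw [← Module.End.mul_apply, (hcd' j i (by rintro rfl; exact hi hj)).eq,
        Module.End.mul_apply, hx j hj]
    have hpow : ∀ n : ℕ, ∀ x : W, (((c i).restrict hcW ^ n) x : V) = (c i ^ n) x := by
      intro n
      induction n with
      | zero => simp
      | succ n ihn =>
        intro x
        rw [pow_succ, pow_succ, Module.End.mul_apply, Module.End.mul_apply, ihn]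
        rfl
    have h := finrank_ker_sub_one_mul hm (a := (c i).restrict hcW) (b := (d i).restrict hdW) (hζ i)
      (fun x y hxy => Subtype.ext (hd i (congrArg Subtype.val hxy)))
      (LinearMap.ext fun x => Subtype.ext (by rw [hpow, hcm]; rfl))
      (LinearMap.ext fun x => Subtype.ext (LinearMap.congr_fun (hcd i) (x : V)))
    have hmap : (⨅ j ∈ insert i S, LinearMap.ker (c j - 1) : Submodule K V) =
        (LinearMap.ker ((c i).restrict hcW - 1)).map W.subtype := by
      ext x
      simp only [Finset.iInf_insert, Submodule.mem_inf, Submodule.mem_map, LinearMap.mem_ker]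
      constructor
      · rintro ⟨h1, h2⟩
        exact ⟨⟨x, h2⟩, Subtype.ext h1, rfl⟩
      · rintro ⟨y, h1, rfl⟩
        exact ⟨congrArg Subtype.val h1, y.2⟩
    rw [hmap, Submodule.finrank_map_subtype_eq, Finset.card_insert_of_notMem hi, pow_succ',
      ← mul_assoc, h, ih]

end FixedSpace

section QuantumMonomials

/-- The standard symplectic form on `ℤ × ℤ`. -/
def symplForm (x y : ℤ × ℤ) : ℤ := x.1 * y.2 - y.1 * x.2

theorem zpow_mul_zpow_of_mul_eq {G : Type*} [Group G] {z a b : G} (hz : ∀ g, Commute z g)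
    (h : a * b = z * (b * a)) (i j : ℤ) : a ^ i * b ^ j = z ^ (i * j) * (b ^ j * a ^ i) := by
  have h1 : a * b ^ j * a⁻¹ = z ^ j * b ^ j := by
    rw [← conj_zpow, h, ← (hz b).mul_zpow, mul_assoc, mul_assoc, mul_inv_cancel, mul_one]
  have h2 : (b ^ j)⁻¹ * a * b ^ j = z ^ j * a := by
    have h3 : a * b ^ j = z ^ j * b ^ j * a := by rw [← h1, inv_mul_cancel_right]
    rw [mul_assoc, h3, ((hz (b ^ j)).zpow_left j).eq, mul_assoc, inv_mul_cancel_left]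
  have h4 : (b ^ j)⁻¹ * a ^ i * b ^ j = z ^ (i * j) * a ^ i := by
    have h5 := conj_zpow (a := (b ^ j)⁻¹) (b := a) (i := i)
    rw [inv_inv, h2] at h5
    rw [← h5, ((hz a).zpow_left j).mul_zpow, ← zpow_mul, mul_comm j i]
  rw [← mul_assoc, ((hz (b ^ j)).zpow_left (i * j)).eq, mul_assoc, ← h4]
  group

theorem zpow_mul_zpow_mul_comm {G : Type*} [Group G] {z a b : G} (hz : ∀ g, Commute z g)
    (h : a * b = z * (b * a)) (x y : ℤ × ℤ) :
    a ^ x.1 * b ^ x.2 * (a ^ y.1 * b ^ y.2) =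
      z ^ symplForm x y * (a ^ y.1 * b ^ y.2 * (a ^ x.1 * b ^ x.2)) := by
  have hswap : ∀ i j : ℤ, b ^ j * a ^ i = z ^ (-(i * j)) * (a ^ i * b ^ j) := by
    intro i j
    rw [zpow_mul_zpow_of_mul_eq hz h, zpow_neg, inv_mul_cancel_left]
  have hexp : ∀ u v : ℤ × ℤ, a ^ u.1 * b ^ u.2 * (a ^ v.1 * b ^ v.2) =
      z ^ (-(v.1 * u.2)) * (a ^ (u.1 + v.1) * b ^ (u.2 + v.2)) := by
    intro u v
    calc a ^ u.1 * b ^ u.2 * (a ^ v.1 * b ^ v.2)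
        = a ^ u.1 * (b ^ u.2 * a ^ v.1) * b ^ v.2 := by group
      _ = (a ^ u.1 * z ^ (-(v.1 * u.2))) * (a ^ v.1 * b ^ u.2) * b ^ v.2 := by
          rw [hswap]; group
      _ = _ := by rw [← ((hz (a ^ u.1)).zpow_left _).eq]; group
  rw [hexp, hexp, ← mul_assoc (z ^ symplForm x y), ← zpow_add, add_comm x.1, add_comm x.2,
    symplForm]
  congr 2
  ring

variable {K A : Type*} [Field K] [Ring A] [Algebra K A]

/-- The monomial `y₁ ^ a * y₂ ^ b` with integral exponents. -/
def quantumMonomial (y₁ y₂ : Aˣ) (x : ℤ × ℤ) : Aˣ := y₁ ^ x.1 * y₂ ^ x.2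

theorem quantumMonomial_mul_comm {θ : Kˣ} {y₁ y₂ : Aˣ}
    (h : (y₁ : A) * y₂ = (θ : K) • ((y₂ : A) * y₁)) (x y : ℤ × ℤ) :
    (quantumMonomial y₁ y₂ x : A) * quantumMonomial y₁ y₂ y =
      ((θ ^ symplForm x y : Kˣ) : K) •
        ((quantumMonomial y₁ y₂ y : A) * quantumMonomial y₁ y₂ x) := by
  set z : Aˣ := Units.map (algebraMap K A).toMonoidHom θ with hz
  have hzc : ∀ g, Commute z g := fun g => Units.ext (Algebra.commutes (θ : K) (g : A))
  have h' : y₁ * y₂ = z * (y₂ * y₁) := Units.ext (by rw [Units.val_mul, h, Algebra.smul_def]; rfl)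
  have h2 := congrArg Units.val (zpow_mul_zpow_mul_comm hzc h' x y)
  rw [hz, ← map_zpow] at h2
  rw [Algebra.smul_def]
  exact h2

theorem quantumMonomial_pow_eq {u₁ u₂ : Kˣ} {y₁ y₂ : Aˣ} {m : ℕ}
    (h₁ : (y₁ : A) ^ m = algebraMap K A u₁) (h₂ : (y₂ : A) ^ m = algebraMap K A u₂) (a : ℤ) :
    (quantumMonomial y₁ y₂ (a, 0) : A) ^ m = algebraMap K A (u₁ ^ a : Kˣ) ∧
    (quantumMonomial y₁ y₂ (0, a) : A) ^ m = algebraMap K A (u₂ ^ a : Kˣ) := by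
  have key : ∀ {u : Kˣ} {y : Aˣ}, (y : A) ^ m = algebraMap K A u →
      ((y ^ a : Aˣ) : A) ^ m = algebraMap K A (u ^ a : Kˣ) := by
    intro u y h
    have h' : y ^ m = Units.map (algebraMap K A).toMonoidHom u := Units.ext (by simpa using h)
    have h2 : (y ^ a) ^ m = Units.map (algebraMap K A).toMonoidHom (u ^ a) := by
      rw [map_zpow, ← h', ← zpow_natCast, ← zpow_natCast, ← zpow_mul, ← zpow_mul, mul_comm]
    exact (Units.val_pow_eq_pow_val _ _).symm.trans (congrArg Units.val h2)
  constructor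
  · simpa [quantumMonomial] using key h₁
  · simpa [quantumMonomial] using key h₂

/-- The monomials with exponents in `[0, m)`. -/
def boundedExponent {m : ℕ} (x : Fin m × Fin m) : ℤ × ℤ := ((x.1 : ℕ), (x.2 : ℕ))

theorem eq_of_zpow_symplForm_eq {θ : Kˣ} {m : ℕ} (hθ : orderOf θ = m) {x y : Fin m × Fin m}
    (h₁ : θ ^ symplForm (1, 0) (boundedExponent x) = θ ^ symplForm (1, 0) (boundedExponent y))
    (h₂ : θ ^ symplForm (0, 1) (boundedExponent x) = θ ^ symplForm (0, 1) (boundedExponent y)) :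
    x = y := by
  have key : ∀ a b : Fin m, θ ^ ((a : ℕ) : ℤ) = θ ^ ((b : ℕ) : ℤ) → a = b := by
    intro a b h
    rw [zpow_natCast, zpow_natCast] at h
    exact Fin.ext (pow_injOn_Iio_orderOf (by simp [hθ]) (by simp [hθ]) h)
  simp only [symplForm, boundedExponent, one_mul, mul_zero, zero_mul, sub_zero, zero_sub, mul_one,
    zpow_neg, inv_inj] at h₁ h₂
  exact Prod.ext (key _ _ h₂) (key _ _ h₁)

end QuantumMonomials

section TensorMonomials

variable {ι K A : Type*} [Field K] [Ring A] [Algebra K A]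

/-- The pure tensor of the monomials with exponents `x i`. -/
def tensorMonomial (K : Type*) [Field K] [Algebra K A] (y₁ y₂ : Aˣ) (x : ι → ℤ × ℤ) :
    (⨂[K] _ : ι, A)ˣ :=
  Units.map (PiTensorProduct.tprodMonoidHom K)
    (MulEquiv.piUnits.symm fun i => quantumMonomial y₁ y₂ (x i))

theorem tensorMonomial_val (y₁ y₂ : Aˣ) (x : ι → ℤ × ℤ) :
    (tensorMonomial K y₁ y₂ x : ⨂[K] _ : ι, A) =
      ⨂ₜ[K] i, (quantumMonomial y₁ y₂ (x i) : A) := rfl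

variable [Fintype ι]

theorem tprod_const_algebraMap (c : ι → K) :
    (⨂ₜ[K] i, algebraMap K A (c i)) = algebraMap K (⨂[K] _ : ι, A) (∏ i, c i) := by
  simp only [Algebra.algebraMap_eq_smul_one]
  exact MultilinearMap.map_smul_univ (PiTensorProduct.tprod K) c (fun _ => (1 : A))

theorem tensorMonomial_mul_comm {θ : Kˣ} {y₁ y₂ : Aˣ}
    (h : (y₁ : A) * y₂ = (θ : K) • ((y₂ : A) * y₁)) (x y : ι → ℤ × ℤ) :
    (tensorMonomial K y₁ y₂ x : ⨂[K] _ : ι, A) * tensorMonomial K y₁ y₂ y =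
      ((θ ^ (∑ i, symplForm (x i) (y i)) : Kˣ) : K) •
        ((tensorMonomial K y₁ y₂ y : ⨂[K] _ : ι, A) * tensorMonomial K y₁ y₂ x) := by
  simp only [tensorMonomial_val, PiTensorProduct.tprod_mul_tprod]
  have h1 : ((θ ^ (∑ i, symplForm (x i) (y i)) : Kˣ) : K) =
      ∏ i, ((θ ^ symplForm (x i) (y i) : Kˣ) : K) := by
    rw [← Units.coe_prod]
    congr 1
    induction (Finset.univ : Finset ι) using Finset.cons_induction with
    | empty => simp
    | cons a s ha ih => rw [Finset.sum_cons, Finset.prod_cons, zpow_add, ih]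
  rw [h1, ← MultilinearMap.map_smul_univ]
  congr 1
  exact funext fun i => quantumMonomial_mul_comm h (x i) (y i)

theorem tensorMonomial_pow_fst {u₁ u₂ : Kˣ} {y₁ y₂ : Aˣ} {m : ℕ}
    (h₁ : (y₁ : A) ^ m = algebraMap K A u₁) (h₂ : (y₂ : A) ^ m = algebraMap K A u₂) (a : ι → ℤ) :
    (tensorMonomial K y₁ y₂ (fun i => (a i, 0)) : ⨂[K] _ : ι, A) ^ m =
      algebraMap K _ ((∏ i, u₁ ^ a i : Kˣ) : K) := by
  rw [Units.coe_prod, ← tprod_const_algebraMap]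
  refine (map_pow (PiTensorProduct.tprodMonoidHom K : (ι → A) →* _)
    (fun i => (quantumMonomial y₁ y₂ (a i, 0) : A)) m).symm.trans ?_
  exact congrArg (PiTensorProduct.tprod K) (funext fun i => (quantumMonomial_pow_eq h₁ h₂ (a i)).1)

theorem tensorMonomial_pow_snd {u₁ u₂ : Kˣ} {y₁ y₂ : Aˣ} {m : ℕ}
    (h₁ : (y₁ : A) ^ m = algebraMap K A u₁) (h₂ : (y₂ : A) ^ m = algebraMap K A u₂) (a : ι → ℤ) :
    (tensorMonomial K y₁ y₂ (fun i => (0, a i)) : ⨂[K] _ : ι, A) ^ m =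
      algebraMap K _ ((∏ i, u₂ ^ a i : Kˣ) : K) := by
  rw [Units.coe_prod, ← tprod_const_algebraMap]
  refine (map_pow (PiTensorProduct.tprodMonoidHom K : (ι → A) →* _)
    (fun i => (quantumMonomial y₁ y₂ (0, a i) : A)) m).symm.trans ?_
  exact congrArg (PiTensorProduct.tprod K) (funext fun i => (quantumMonomial_pow_eq h₁ h₂ (a i)).2)

end TensorMonomials

/-- The units `y₁, y₂` generate `A` as the cyclic algebra `(u₁, u₂; m, K, θ)`. -/
structure IsCyclicPair {K A : Type*} [Field K] [Ring A] [Algebra K A] (m : ℕ) (θ u₁ u₂ : Kˣ)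
    (y₁ y₂ : Aˣ) : Prop where
  orderOf_eq : orderOf θ = m
  pos : 0 < m
  mul_comm_smul : (y₁ : A) * y₂ = (θ : K) • ((y₂ : A) * y₁)
  pow_fst : (y₁ : A) ^ m = algebraMap K A u₁
  pow_snd : (y₂ : A) ^ m = algebraMap K A u₂
  span_eq_top : Submodule.span K (Set.range fun x : Fin m × Fin m =>
    (quantumMonomial y₁ y₂ (boundedExponent x) : A)) = ⊤

namespace IsCyclicPair

variable {K A : Type*} [Field K] [Ring A] [Algebra K A] {m : ℕ}
  {θ u₁ u₂ : Kˣ} {y₁ y₂ : Aˣ} (h : IsCyclicPair m θ u₁ u₂ y₁ y₂)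

include h

theorem exponent_ext {x y : Fin m × Fin m} (hxy : ∀ p : ℤ × ℤ,
    ((θ ^ symplForm p (boundedExponent x) : Kˣ) : K) =
      ((θ ^ symplForm p (boundedExponent y) : Kˣ) : K)) : x = y :=
  eq_of_zpow_symplForm_eq h.orderOf_eq (Units.ext (hxy _)) (Units.ext (hxy _))

variable [Nontrivial A]

theorem isSimpleRing : IsSimpleRing A :=
  isSimpleRing_of_eigenunits _ (quantumMonomial y₁ y₂) _ (fun _ _ => h.exponent_ext)
    (fun p x => quantumMonomial_mul_comm h.mul_comm_smul p (boundedExponent x)) h.span_eq_top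

theorem isCentral : Algebra.IsCentral K A :=
  isCentral_of_eigenunits _ (quantumMonomial y₁ y₂) _ (fun _ _ => h.exponent_ext)
    (fun p x => quantumMonomial_mul_comm h.mul_comm_smul p (boundedExponent x)) h.span_eq_top
    (⟨0, h.pos⟩, ⟨0, h.pos⟩) (by simp [quantumMonomial, boundedExponent])

/-- The basis of monomials. -/
def basis : Basis (Fin m × Fin m) K A :=
  Basis.mk (linearIndependent_eigenunits _ (quantumMonomial y₁ y₂) _ (fun _ _ => h.exponent_ext)
    (fun p x => quantumMonomial_mul_comm h.mul_comm_smul p (boundedExponent x))) h.span_eq_top.ge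

theorem basis_apply (x : Fin m × Fin m) :
    h.basis x = quantumMonomial y₁ y₂ (boundedExponent x) := Basis.mk_apply _ _ _

theorem finiteDimensional : FiniteDimensional K A := h.basis.finiteDimensional_of_finite

variable (ι : Type*) [Fintype ι]

theorem finrank_tensorPower : finrank K (⨂[K] _ : ι, A) = (m * m) ^ Fintype.card ι := by
  classical
  rw [finrank_eq_card_basis (Basis.piTensorProduct fun _ : ι => h.basis)]
  simp

theorem finiteDimensional_tensorPower : FiniteDimensional K (⨂[K] _ : ι, A) :=
  (Basis.piTensorProduct fun _ : ι => h.basis).finiteDimensional_of_finite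

theorem nontrivial_tensorPower : Nontrivial (⨂[K] _ : ι, A) :=
  nontrivial_of_finrank_pos (R := K) (by
    rw [h.finrank_tensorPower]
    have := h.pos
    positivity)

theorem isSimpleRing_tensorPower : IsSimpleRing (⨂[K] _ : ι, A) := by
  classical
  have := h.nontrivial_tensorPower ι
  have hb := (Basis.piTensorProduct fun _ : ι => h.basis).span_eq
  have hb' : (Basis.piTensorProduct fun _ : ι => h.basis : _ → ⨂[K] _ : ι, A) = fun x =>
      (tensorMonomial K y₁ y₂ (fun i => boundedExponent (x i)) : ⨂[K] _ : ι, A) := by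
    funext x
    simp only [Basis.piTensorProduct_apply, h.basis_apply, tensorMonomial_val]
  rw [hb'] at hb
  refine isSimpleRing_of_eigenunits _ (tensorMonomial K y₁ y₂) _ ?_
    (fun p x => tensorMonomial_mul_comm h.mul_comm_smul p _) hb
  intro x y hxy
  refine funext fun i => h.exponent_ext fun p => ?_
  have hs : ∀ z : ι → Fin m × Fin m, ∑ j, symplForm (Pi.single (M := fun _ => ℤ × ℤ) i p j)
      (boundedExponent (z j)) = symplForm p (boundedExponent (z i)) := by
    intro z
    rw [Finset.sum_eq_single_of_mem i (Finset.mem_univ i), Pi.single_eq_same]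
    intro j _ hj
    simp [Pi.single_eq_of_ne hj, symplForm]
  simpa only [hs] using hxy (Pi.single i p)

end IsCyclicPair

theorem exists_algEquiv_matrix_of_fixed {K B ι : Type*} [Field K] [CharZero K] [Ring B]
    [Algebra K B] [FiniteDimensional K B] [IsSimpleRing B] [Fintype ι] [DecidableEq ι] {m N : ℕ}
    (hm : 0 < m) (hN : N = m ^ Fintype.card ι) (hdim : finrank K B = N * N)
    (c : ι → B) (d : ι → Bˣ) (ζ : ι → K) (hζ : ∀ i, IsPrimitiveRoot (ζ i) m)
    (hcm : ∀ i, c i ^ m = 1) (hcc : ∀ i j, Commute (c i) (c j))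
    (hcd : ∀ i, d i * c i = ζ i • (c i * d i))
    (hcd' : ∀ i j, i ≠ j → Commute (c i) (d j)) :
    Nonempty (B ≃ₐ[K] Matrix (Fin N) (Fin N) K) := by
  have hN0 : 0 < N := hN ▸ pow_pos hm _
  let W : Submodule B B :=
    { carrier := {w | ∀ i, w * c i = w}
      add_mem' := fun ha hb i => by rw [add_mul, ha i, hb i]
      zero_mem' := fun i => zero_mul _
      smul_mem' := fun b w hw i => by rw [smul_eq_mul, mul_assoc, hw i] }
  have hmul : ∀ a b : B, LinearMap.mulRight K a * LinearMap.mulRight K b =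
      LinearMap.mulRight K (b * a) := fun a b => by
    ext x
    simp [mul_assoc]
  have hpow : ∀ (a : B) (n : ℕ), LinearMap.mulRight K a ^ n = LinearMap.mulRight K (a ^ n) := by
    intro a n
    induction n with
    | zero => ext x; simp
    | succ n ih => rw [pow_succ, ih, hmul, pow_succ']
  have hfix := finrank_iInf_ker_sub_one_mul hm (fun i => LinearMap.mulRight K (c i))
    (fun i => LinearMap.mulRight K (d i : B)) ζ hζ
    (fun i x y hxy => (Units.mul_left_inj (d i)).mp hxy)
    (fun i => by rw [hpow, hcm]; ext x; simp)
    (fun i j => by rw [Commute, SemiconjBy, hmul, hmul, (hcc i j).eq])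
    (fun i => by
      rw [hmul, hmul, hcd]
      ext x
      simp [mul_assoc])
    (fun i j hij => by rw [Commute, SemiconjBy, hmul, hmul, (hcd' i j hij).eq]) Finset.univ
  have hW : (⨅ i ∈ Finset.univ, LinearMap.ker (LinearMap.mulRight K (c i) - 1) :
      Submodule K B) = W.restrictScalars K := by
    ext x
    simp [Submodule.mem_iInf, sub_eq_zero, W]
  rw [hW, Finset.card_univ, ← hN, hdim] at hfix
  have hWN : finrank K W = N := Nat.eq_of_mul_eq_mul_right hN0 hfix
  have : Nontrivial W := nontrivial_of_finrank_pos (R := K) (hWN ▸ hN0)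
  have hWfd : FiniteDimensional K W := FiniteDimensional.of_finrank_pos (hWN ▸ hN0)
  let ψ : B →ₐ[K] End K W := Algebra.lsmul K K W
  have hinj : Function.Injective ψ := RingHom.injective (ψ : B →+* End K W)
  have hbij : Function.Bijective ψ := ⟨hinj,
    (LinearMap.injective_iff_surjective_of_finrank_eq_finrank (f := ψ.toLinearMap)
      (by rw [hdim, finrank_linearMap, hWN])).mp hinj⟩
  exact ⟨(AlgEquiv.ofBijective ψ hbij).trans (algEquivMatrix (finBasisOfFinrankEq K W hWN))⟩

section Exponents

variable {ι K A : Type*} [Fintype ι] [Field K] [Ring A] [Algebra K A]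

/-- The pure tensor of the powers `y₁ ^ p i`. -/
def tensorFst (K : Type*) [Field K] [Algebra K A] (y₁ y₂ : Aˣ) (p : ι → ℤ) : (⨂[K] _ : ι, A)ˣ :=
  tensorMonomial K y₁ y₂ fun i => (p i, 0)

/-- The pure tensor of the powers `y₂ ^ q i`. -/
def tensorSnd (K : Type*) [Field K] [Algebra K A] (y₁ y₂ : Aˣ) (q : ι → ℤ) : (⨂[K] _ : ι, A)ˣ :=
  tensorMonomial K y₁ y₂ fun i => (0, q i)

variable {m : ℕ} {θ u₁ u₂ : Kˣ} {y₁ y₂ : Aˣ} (h : IsCyclicPair m θ u₁ u₂ y₁ y₂)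

include h

theorem commute_tensorFst (p q : ι → ℤ) :
    Commute (tensorFst K y₁ y₂ p : ⨂[K] _ : ι, A) (tensorFst K y₁ y₂ q) :=
  (tensorMonomial_mul_comm h.mul_comm_smul _ _).trans (by simp [symplForm]; rfl)

theorem tensorFst_mul_tensorSnd (p q : ι → ℤ) :
    (tensorFst K y₁ y₂ p : ⨂[K] _ : ι, A) * tensorSnd K y₁ y₂ q =
      ((θ ^ (p ⬝ᵥ q) : Kˣ) : K) •
        ((tensorSnd K y₁ y₂ q : ⨂[K] _ : ι, A) * tensorFst K y₁ y₂ p) :=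
  (tensorMonomial_mul_comm h.mul_comm_smul _ _).trans (by simp [symplForm, dotProduct]; rfl)

theorem commute_tensorFst_tensorSnd {p q : ι → ℤ} (hpq : p ⬝ᵥ q = 0) :
    Commute (tensorFst K y₁ y₂ p : ⨂[K] _ : ι, A) (tensorSnd K y₁ y₂ q) :=
  (tensorFst_mul_tensorSnd h p q).trans (by simp [hpq])

theorem commute_tensorSnd (p q : ι → ℤ) :
    Commute (tensorSnd K y₁ y₂ p : ⨂[K] _ : ι, A) (tensorSnd K y₁ y₂ q) :=
  (tensorMonomial_mul_comm h.mul_comm_smul _ _).trans (by simp [symplForm]; rfl)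

theorem tensorFst_pow (p : ι → ℤ) : (tensorFst K y₁ y₂ p : ⨂[K] _ : ι, A) ^ m =
    algebraMap K _ ((∏ i, u₁ ^ p i : Kˣ) : K) :=
  tensorMonomial_pow_fst h.pow_fst h.pow_snd p

theorem tensorSnd_pow (q : ι → ℤ) : (tensorSnd K y₁ y₂ q : ⨂[K] _ : ι, A) ^ m =
    algebraMap K _ ((∏ i, u₂ ^ q i : Kˣ) : K) :=
  tensorMonomial_pow_snd h.pow_fst h.pow_snd q

variable [DecidableEq ι]

theorem tensorFst_single_sub_single_pow (i j : ι) :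
    (tensorFst K y₁ y₂ (Pi.single i 1 - Pi.single j 1) : ⨂[K] _ : ι, A) ^ m = 1 := by
  have hs : ∀ i : ι, ∏ x, u₁ ^ (Pi.single (M := fun _ => ℤ) i 1 x) = u₁ := by
    intro i
    rw [Finset.prod_eq_single_of_mem i (Finset.mem_univ i), Pi.single_eq_same, zpow_one]
    intro j _ hj
    rw [Pi.single_eq_of_ne hj, zpow_zero]
  rw [tensorFst_pow h]
  simp [zpow_sub, Finset.prod_mul_distrib, hs]

theorem tensorFst_single_pow (i : ι) :
    (tensorFst K y₁ y₂ (Pi.single i 1) : ⨂[K] _ : ι, A) ^ m = algebraMap K _ (u₁ : K) := by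
  rw [tensorFst_pow h, Finset.prod_eq_single_of_mem i (Finset.mem_univ i), Pi.single_eq_same,
    zpow_one]
  intro j _ hj
  rw [Pi.single_eq_of_ne hj, zpow_zero]

omit [DecidableEq ι] in
theorem tensorSnd_one_pow : (tensorSnd K y₁ y₂ (1 : ι → ℤ) : ⨂[K] _ : ι, A) ^ m =
    algebraMap K _ ((u₂ : K) ^ Fintype.card ι) := by
  rw [tensorSnd_pow h]
  simp

end Exponents

section SplitPower

variable {ι K A : Type*} [Fintype ι] [DecidableEq ι] [Field K] [CharZero K] [Ring A] [Algebra K A]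
  [Nontrivial A] {m : ℕ} {θ u₁ u₂ : Kˣ} {y₁ y₂ : Aˣ}

theorem IsCyclicPair.isPrimitiveRoot {K A : Type*} [Field K] [Ring A] [Algebra K A] {m : ℕ}
    {θ u₁ u₂ : Kˣ} {y₁ y₂ : Aˣ} (h : IsCyclicPair m θ u₁ u₂ y₁ y₂) :
    IsPrimitiveRoot (θ : K) m := by
  have := IsPrimitiveRoot.orderOf (θ : K)
  rwa [orderOf_units, h.orderOf_eq] at this

/-- The `m`-th tensor power of a cyclic algebra of degree `m` is split. -/
theorem IsCyclicPair.exists_algEquiv_matrix (h : IsCyclicPair m θ u₁ u₂ y₁ y₂)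
    (hcard : Fintype.card ι = m) :
    Nonempty ((⨂[K] _ : ι, A) ≃ₐ[K] Matrix (Fin (m ^ m)) (Fin (m ^ m)) K) := by
  obtain ⟨i₀⟩ : Nonempty ι := Fintype.card_pos_iff.mp (hcard ▸ h.pos)
  have := h.finiteDimensional_tensorPower ι
  have := h.isSimpleRing_tensorPower ι
  refine exists_algEquiv_matrix_of_fixed h.pos (by rw [hcard])
    (by rw [h.finrank_tensorPower, hcard, mul_pow])
    (fun i => if i = i₀ then (u₂⁻¹ : K) • (tensorSnd K y₁ y₂ (1 : ι → ℤ) : ⨂[K] _ : ι, A)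
      else tensorFst K y₁ y₂ (Pi.single i 1 - Pi.single i₀ 1))
    (fun i => if i = i₀ then tensorFst K y₁ y₂ (Pi.single i₀ 1)
      else tensorSnd K y₁ y₂ (Pi.single i 1))
    (fun i => if i = i₀ then (θ : K) else (θ : K)⁻¹) ?_ ?_ ?_ ?_ ?_
  · intro i
    split_ifs
    · exact h.isPrimitiveRoot
    · exact h.isPrimitiveRoot.inv
  · intro i
    split_ifs
    · rw [smul_pow, tensorSnd_one_pow h, hcard, Algebra.algebraMap_eq_smul_one, smul_smul, inv_pow,
        inv_mul_cancel₀ (pow_ne_zero _ u₂.ne_zero), one_smul]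
    · exact tensorFst_single_sub_single_pow h _ _
  · have key : ∀ i, Commute (tensorFst K y₁ y₂ (Pi.single i 1 - Pi.single i₀ 1) : ⨂[K] _ : ι, A)
        ((u₂⁻¹ : K) • (tensorSnd K y₁ y₂ (1 : ι → ℤ) : ⨂[K] _ : ι, A)) := fun i =>
      (commute_tensorFst_tensorSnd h (by simp [sub_dotProduct])).smul_right _
    intro i j
    split_ifs
    · exact Commute.refl _
    · exact (key j).symm
    · exact key i
    · exact commute_tensorFst h _ _
  · intro i
    split_ifs with hi
    · rw [mul_smul_comm, tensorFst_mul_tensorSnd h, smul_mul_assoc, smul_comm]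
      simp
    · rw [tensorFst_mul_tensorSnd h, smul_smul]
      simp [hi]
  · intro i j hij
    split_ifs with hi hj hj
    · exact absurd (hi.trans hj.symm) hij
    · exact (commute_tensorSnd h _ _).smul_left _
    · exact commute_tensorFst h _ _
    · exact commute_tensorFst_tensorSnd h (by simp [Ne.symm hj, Ne.symm hij])

end SplitPower

section NonsplitPower

variable {ι K A : Type*} [Fintype ι] [DecidableEq ι] [Field K] [Ring A] [Algebra K A]
  {m : ℕ} {θ u₁ u₂ : Kˣ} {y₁ y₂ : Aˣ}

/-- If a tensor power of a cyclic algebra acts on a space of minimal dimension over an extension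
`φ : K → L` containing an `m`-th root of `u₁`, compatibly with a semilinear map of order `m`, then
the corresponding power of `u₂` is a norm. -/
theorem IsCyclicPair.exists_norm_eq (h : IsCyclicPair m θ u₁ u₂ y₁ y₂) (i₀ : ι) {L V : Type*}
    [Field L] [CharZero L] [AddCommGroup V] [Module L V] [FiniteDimensional L V] (φ : K →+* L)
    (τ : L → L) (F : (⨂[K] _ : ι, A) →+* End L V) (hF : ∀ x b, F (x • b) = φ x • F b) (σ : V → V)
    (hσ : ∀ (l : L) (x : V), σ (l • x) = τ l • σ x) (hσF : ∀ b x, σ (F b x) = F b (σ x))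
    (hσm : σ^[m] = id) (hdim : finrank L V = m ^ Fintype.card ι) {s : L} (hs : s ^ m = φ u₁)
    (hτs : τ s = (φ θ)⁻¹ * s) :
    ∃ g : L, φ u₂ ^ Fintype.card ι = ∏ j ∈ Finset.range m, τ^[j] g := by
  have hs0 : s ≠ 0 := by
    rintro rfl
    rw [zero_pow h.pos.ne', eq_comm, map_eq_zero] at hs
    exact u₁.ne_zero hs
  have hφθ : φ θ ≠ 0 := (map_ne_zero φ).mpr θ.ne_zero
  have hF1 : ∀ x, F (algebraMap K _ x) = φ x • 1 := by
    intro x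
    rw [Algebra.algebraMap_eq_smul_one, hF, map_one]
  have hunit : ∀ u : (⨂[K] _ : ι, A)ˣ, Function.Injective (F u) := fun u =>
    ((Module.End.isUnit_iff _).mp (u.isUnit.map F)).1
  set v : ⨂[K] _ : ι, A := (tensorSnd K y₁ y₂ (1 : ι → ℤ)).val with hv
  set u : ⨂[K] _ : ι, A := (tensorFst K y₁ y₂ (Pi.single i₀ 1)).val with hu
  have huv : F u * F v = φ θ • (F v * F u) := by
    rw [← map_mul, hu, hv, tensorFst_mul_tensorSnd h, hF, ← map_mul]
    simp
  have hav : ∀ i, Commute (tensorFst K y₁ y₂ (Pi.single i 1 - Pi.single i₀ 1) : ⨂[K] _ : ι, A)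
      v := fun i => commute_tensorFst_tensorSnd h (by simp [sub_dotProduct])
  have hfix := finrank_iInf_ker_sub_one_mul h.pos
    (fun i => if i = i₀ then s⁻¹ • F u
      else F (tensorFst K y₁ y₂ (Pi.single i 1 - Pi.single i₀ 1) : ⨂[K] _ : ι, A))
    (fun i => F (if i = i₀ then tensorSnd K y₁ y₂ (1 : ι → ℤ)
      else tensorSnd K y₁ y₂ (Pi.single i 1) : (⨂[K] _ : ι, A)ˣ))
    (fun _ => φ θ) (fun _ => h.isPrimitiveRoot.map_of_injective φ.injective) (fun _ => hunit _)
    ?_ ?_ ?_ ?_ Finset.univ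
  · set W : Submodule L V := ⨅ i ∈ Finset.univ, LinearMap.ker ((if i = i₀ then s⁻¹ • F u
      else F (tensorFst K y₁ y₂ (Pi.single i 1 - Pi.single i₀ 1) : ⨂[K] _ : ι, A)) - 1) with hW
    have hmem : ∀ x, x ∈ W ↔ F u x = s • x ∧ ∀ i ≠ i₀,
        F (tensorFst K y₁ y₂ (Pi.single i 1 - Pi.single i₀ 1) : ⨂[K] _ : ι, A) x = x := by
      intro x
      simp only [hW, Submodule.mem_iInf, Finset.mem_univ, forall_const, LinearMap.mem_ker,
        LinearMap.sub_apply, Module.End.one_apply, sub_eq_zero]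
      constructor
      · intro hx
        refine ⟨?_, fun i hi => by simpa [hi] using hx i⟩
        have := hx i₀
        rwa [if_pos rfl, LinearMap.smul_apply, inv_smul_eq_iff₀ hs0] at this
      · rintro ⟨h1, h2⟩ i
        split_ifs with hi
        · rw [LinearMap.smul_apply, h1, inv_smul_smul₀ hs0]
        · exact h2 i hi
    have hW1 : finrank L W = 1 := by
      rw [hdim, Finset.card_univ] at hfix
      exact Nat.eq_of_mul_eq_mul_right (pow_pos h.pos _) (hfix.trans (one_mul _).symm)
    obtain ⟨⟨w, hwW⟩, hw0, hw⟩ := finrank_eq_one_iff'.mp hW1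
    have hwm := (hmem w).mp hwW
    have hvw : F v (σ w) ∈ W := by
      rw [hmem]
      constructor
      · rw [← Module.End.mul_apply, huv, LinearMap.smul_apply, Module.End.mul_apply, ← hσF, hwm.1,
          hσ, hτs, map_smul, smul_smul, mul_inv_cancel_left₀ hφθ]
      · intro i hi
        rw [← Module.End.mul_apply, ← map_mul, (hav i).eq, map_mul, Module.End.mul_apply, ← hσF,
          hwm.2 i hi]
    obtain ⟨g, hg⟩ := hw ⟨_, hvw⟩
    have hg' : F v (σ w) = g • w := (congrArg Subtype.val hg).symm
    refine ⟨g, ?_⟩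
    have hσn : ∀ (n : ℕ) (l : L) (x : V), σ^[n] (l • x) = τ^[n] l • σ^[n] x := by
      intro n
      induction n with
      | zero => simp
      | succ n ih => intro l x; simp only [Function.iterate_succ_apply, hσ, ih]
    have hσFn : ∀ (n : ℕ) (x : V), σ^[n] (F v x) = F v (σ^[n] x) := by
      intro n
      induction n with
      | zero => simp
      | succ n ih => intro x; simp only [Function.iterate_succ_apply, hσF, ih]
    have hiter : ∀ n : ℕ, (F v ^ n) (σ^[n] w) = (∏ j ∈ Finset.range n, τ^[j] g) • w := by
      intro n
      induction n with
      | zero => simp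
      | succ n ih =>
        rw [Function.iterate_succ_apply, pow_succ, Module.End.mul_apply, ← hσFn, hg', hσn, map_smul,
          ih, smul_smul, Finset.prod_range_succ, mul_comm]
    have hm := hiter m
    rw [hσm, ← map_pow, hv, tensorSnd_one_pow h, hF1, LinearMap.smul_apply, map_pow] at hm
    have hw0' : w ≠ 0 := fun hw => hw0 (Subtype.ext hw)
    exact smul_left_injective L hw0' hm
  · intro i
    split_ifs
    · rw [smul_pow, ← map_pow, hu, tensorFst_single_pow h, hF1, smul_smul, inv_pow, hs,
        inv_mul_cancel₀ ((map_ne_zero φ).mpr u₁.ne_zero), one_smul]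
    · rw [← map_pow, tensorFst_single_sub_single_pow h, map_one]
  · intro i j
    split_ifs
    · exact Commute.refl _
    · exact ((commute_tensorFst h _ _).map F).smul_left _
    · exact ((commute_tensorFst h _ _).map F).smul_right _
    · exact (commute_tensorFst h _ _).map F
  · intro i
    split_ifs with hi
    · rw [smul_mul_assoc, huv, mul_smul_comm, smul_comm]
    · rw [← map_mul, tensorFst_mul_tensorSnd h, hF, ← map_mul]
      simp [Ne.symm hi]
  · intro i j hij
    split_ifs with hi hj hj
    · exact absurd (hi.trans hj.symm) hij
    · exact ((commute_tensorFst_tensorSnd h (by simp [hj])).map F).smul_left _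
    · exact (hav i).map F
    · exact (commute_tensorFst_tensorSnd h
        (by simp [Ne.symm hj, Ne.symm hij])).map F

end NonsplitPower

section RationalFunctions

open MvPolynomial

variable {k : Type*} [Field k]

/-- The endomorphism of `k(t₁, t₂)` induced by an injective endomorphism of `k[t₁, t₂]`. -/
def fracMap (g : MvPolynomial (Fin 2) k →ₐ[k] MvPolynomial (Fin 2) k)
    (hg : Function.Injective g) : KTwo k →+* KTwo k :=
  IsFractionRing.lift
    (g := (algebraMap _ (KTwo k)).comp (g : MvPolynomial (Fin 2) k →+* MvPolynomial (Fin 2) k))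
    ((IsFractionRing.injective (MvPolynomial (Fin 2) k) (KTwo k)).comp hg)

theorem fracMap_algebraMap {g : MvPolynomial (Fin 2) k →ₐ[k] MvPolynomial (Fin 2) k}
    (hg : Function.Injective g) (p : MvPolynomial (Fin 2) k) :
    fracMap g hg (algebraMap _ (KTwo k) p) = algebraMap _ (KTwo k) (g p) :=
  IsFractionRing.lift_algebraMap _ p

theorem fracMap_algebraMap_base {g : MvPolynomial (Fin 2) k →ₐ[k] MvPolynomial (Fin 2) k}
    (hg : Function.Injective g) (c : k) :
    fracMap g hg (algebraMap k (KTwo k) c) = algebraMap k (KTwo k) c := by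
  rw [IsScalarTower.algebraMap_apply k (MvPolynomial (Fin 2) k) (KTwo k), fracMap_algebraMap,
    AlgHom.commutes]

theorem fracMap_fracMap {g₁ g₂ g₃ : MvPolynomial (Fin 2) k →ₐ[k] MvPolynomial (Fin 2) k}
    (hg₁ : Function.Injective g₁) (hg₂ : Function.Injective g₂) (hg₃ : Function.Injective g₃)
    (hg : g₁.comp g₂ = g₃) (x : KTwo k) : fracMap g₁ hg₁ (fracMap g₂ hg₂ x) = fracMap g₃ hg₃ x := by
  have : (fracMap g₁ hg₁).comp (fracMap g₂ hg₂) = fracMap g₃ hg₃ :=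
    IsFractionRing.ringHom_ext (A := MvPolynomial (Fin 2) k) fun p => by
      rw [RingHom.comp_apply, fracMap_algebraMap, fracMap_algebraMap, fracMap_algebraMap, ← hg,
        AlgHom.comp_apply]
  exact RingHom.congr_fun this x

/-- The substitution `t₁ ↦ a t₁`, `t₂ ↦ t₂`. -/
def scaleFst (a : k) : MvPolynomial (Fin 2) k →ₐ[k] MvPolynomial (Fin 2) k :=
  aeval ![C a * X 0, X 1]

/-- The substitution `t₁ ↦ t₁ ^ m`, `t₂ ↦ t₂`. -/
def powFst (k : Type*) [Field k] (m : ℕ) : MvPolynomial (Fin 2) k →ₐ[k] MvPolynomial (Fin 2) k :=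
  aeval ![X 0 ^ m, X 1]

theorem scaleFst_comp_scaleFst (a b : k) :
    (scaleFst a).comp (scaleFst b) = scaleFst (a * b) := by
  refine algHom_ext fun i => ?_
  fin_cases i
  · simp [scaleFst, algHom_C]
    ring
  · simp [scaleFst]

theorem scaleFst_one : scaleFst (1 : k) = AlgHom.id k _ := by
  refine algHom_ext fun i => ?_
  fin_cases i <;> simp [scaleFst]

theorem scaleFst_injective (a : kˣ) : Function.Injective (scaleFst (a : k)) := by
  refine Function.LeftInverse.injective (g := scaleFst ((a⁻¹ : kˣ) : k)) fun p => ?_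
  rw [← AlgHom.comp_apply, scaleFst_comp_scaleFst, Units.inv_mul, scaleFst_one, AlgHom.id_apply]

theorem powFst_injective {m : ℕ} (hm : 0 < m) : Function.Injective (powFst k m) := by
  have : (aeval ![X 0, X 1 ^ m] : MvPolynomial (Fin 2) k →ₐ[k] MvPolynomial (Fin 2) k).comp
      (powFst k m) = expand m := by
    refine algHom_ext fun i => ?_
    fin_cases i <;> simp [powFst]
  have hinj := expand_injective (σ := Fin 2) (R := k) hm
  rw [← this, AlgHom.coe_comp] at hinj
  exact hinj.of_comp

theorem scaleFst_comp_powFst {a : k} {m : ℕ} (ha : a ^ m = 1) :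
    (scaleFst a).comp (powFst k m) = powFst k m := by
  refine algHom_ext fun i => ?_
  fin_cases i
  · simp [scaleFst, powFst, mul_pow, ← C_pow, ha]
  · simp [scaleFst, powFst]

theorem scaleFst_comp_expand {a : k} {m : ℕ} (ha : a ^ m = 1) :
    (scaleFst a).comp (expand m) = expand m := by
  refine algHom_ext fun i => ?_
  fin_cases i
  · simp [scaleFst, mul_pow, ← C_pow, ha]
  · simp [scaleFst]

theorem coeff_scaleFst (a : k) (p : MvPolynomial (Fin 2) k) (d : Fin 2 →₀ ℕ) :
    coeff d (scaleFst a p) = a ^ d 0 * coeff d p := by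
  induction p using MvPolynomial.induction_on' with
  | monomial u c =>
    have : scaleFst a (monomial u c) = C (a ^ u 0) * monomial u c := by
      rw [scaleFst, aeval_monomial, monomial_eq, Finsupp.prod_fintype _ _ (by simp),
        Finsupp.prod_fintype _ _ (by simp), Fin.prod_univ_two, Fin.prod_univ_two, algebraMap_eq]
      simp
      ring
    rw [this, coeff_C_mul, coeff_monomial]
    split_ifs with h
    · rw [h]
    · simp
  | add p q hp hq => rw [map_add, coeff_add, coeff_add, hp, hq, mul_add]

theorem totalDegree_scaleFst (a : kˣ) (p : MvPolynomial (Fin 2) k) :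
    (scaleFst (a : k) p).totalDegree = p.totalDegree := by
  have : (scaleFst (a : k) p).support = p.support := by
    ext d
    simp [MvPolynomial.mem_support_iff, coeff_scaleFst]
  rw [totalDegree, totalDegree, this]

theorem totalDegree_prod_scaleFst (a : ℕ → kˣ) {p : MvPolynomial (Fin 2) k} (hp : p ≠ 0) (m : ℕ) :
    (∏ j ∈ Finset.range m, scaleFst (a j : k) p).totalDegree = m * p.totalDegree := by
  have h0 : ∀ j, scaleFst (a j : k) p ≠ 0 := fun j =>
    (map_ne_zero_iff _ (scaleFst_injective _)).mpr hp
  induction m with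
  | zero => simp
  | succ m ih =>
    rw [Finset.prod_range_succ, totalDegree_mul_of_isDomain (Finset.prod_ne_zero_iff.mpr
      fun j _ => h0 j) (h0 m), ih, totalDegree_scaleFst, Nat.succ_mul]

/-- The automorphism `t₁ ↦ a t₁`, `t₂ ↦ t₂` of `k(t₁, t₂)`. -/
def fracScale (a : kˣ) : KTwo k →+* KTwo k := fracMap (scaleFst (a : k)) (scaleFst_injective a)

theorem fracScale_one : fracScale (1 : kˣ) = RingHom.id (KTwo k) :=
  IsFractionRing.ringHom_ext (A := MvPolynomial (Fin 2) k) fun p => by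
    rw [fracScale, fracMap_algebraMap, Units.val_one, scaleFst_one, AlgHom.id_apply,
      RingHom.id_apply]

theorem fracScale_iterate (a : kˣ) (n : ℕ) : (fracScale a)^[n] = fracScale (a ^ n) := by
  induction n with
  | zero => simp [fracScale_one]
  | succ n ih =>
    funext x
    rw [Function.iterate_succ_apply, ih]
    exact fracMap_fracMap _ _ _ (by rw [scaleFst_comp_scaleFst, pow_succ, Units.val_mul]) x

theorem fracScale_iterate_eq_id {a : kˣ} {m : ℕ} (ha : a ^ m = 1) : (fracScale a)^[m] = id := by
  rw [fracScale_iterate, ha, fracScale_one, RingHom.coe_id]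

theorem fracScale_fst (a : kˣ) : fracScale a (tv k 0) = algebraMap k (KTwo k) a * tv k 0 := by
  rw [fracScale, tv, fracMap_algebraMap,
    IsScalarTower.algebraMap_apply k (MvPolynomial (Fin 2) k) (KTwo k), ← map_mul]
  simp [scaleFst, algebraMap_eq]

theorem fracScale_snd (a : kˣ) : fracScale a (tv k 1) = tv k 1 := by
  rw [fracScale, tv, fracMap_algebraMap]
  simp [scaleFst]

theorem tv_ne_zero (i : Fin 2) : tv k i ≠ 0 :=
  (map_ne_zero_iff _ (IsFractionRing.injective (MvPolynomial (Fin 2) k) (KTwo k))).mpr (X_ne_zero i)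

/-- A power of `t₂` which is a norm for the automorphism `t₁ ↦ a t₁` has exponent divisible by the
degree. -/
theorem dvd_of_pow_eq_prod (a : kˣ) {m r : ℕ} (hm : 0 < m) {g : KTwo k}
    (h : tv k 1 ^ r = ∏ j ∈ Finset.range m, (fracScale a)^[j] g) : m ∣ r := by
  obtain ⟨P, Q, hQ, rfl⟩ := IsFractionRing.div_surjective (MvPolynomial (Fin 2) k) g
  have hQ0 : Q ≠ 0 := nonZeroDivisors.ne_zero hQ
  have hit : ∀ j, (fracScale a)^[j] (algebraMap _ (KTwo k) P / algebraMap _ (KTwo k) Q) =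
      algebraMap _ (KTwo k) (scaleFst ((a ^ j : kˣ) : k) P) /
        algebraMap _ (KTwo k) (scaleFst ((a ^ j : kˣ) : k) Q) := by
    intro j
    rw [fracScale_iterate, map_div₀, fracScale, fracMap_algebraMap, fracMap_algebraMap]
  have hne : ∏ j ∈ Finset.range m, scaleFst ((a ^ j : kˣ) : k) Q ≠ 0 :=
    Finset.prod_ne_zero_iff.mpr fun j _ => (map_ne_zero_iff _ (scaleFst_injective _)).mpr hQ0
  simp only [hit, Finset.prod_div_distrib, ← map_prod] at h
  rw [eq_div_iff ((map_ne_zero_iff _ (IsFractionRing.injective _ _)).mpr hne), tv, ← map_pow,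
    ← map_mul] at h
  have hpoly := IsFractionRing.injective (MvPolynomial (Fin 2) k) (KTwo k) h
  have hP0 : P ≠ 0 := by
    rintro rfl
    simp only [map_zero, Finset.prod_const, Finset.card_range, zero_pow hm.ne'] at hpoly
    exact mul_ne_zero (pow_ne_zero _ (X_ne_zero _)) hne hpoly
  have hdeg := congrArg totalDegree hpoly
  rw [totalDegree_mul_of_isDomain (pow_ne_zero _ (X_ne_zero _)) hne, totalDegree_X_pow,
    totalDegree_prod_scaleFst _ hQ0, totalDegree_prod_scaleFst _ hP0] at hdeg
  exact (Nat.dvd_add_left (Dvd.intro _ rfl)).mp (hdeg ▸ Dvd.intro _ rfl)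

end RationalFunctions

section CyclicAlgebra

variable {k : Type*} [Field k] {m : ℕ}

/-- The generators of a cyclic algebra. -/
def cyclicGen (m : ℕ) (θ : k) (u₁ u₂ : KTwo k) (i : Fin 2) : CyclicAlg k m θ u₁ u₂ :=
  RingQuot.mkAlgHom (KTwo k) (CycRel k m θ u₁ u₂) (FreeAlgebra.ι (KTwo k) i)

theorem cyclicGen_mul_comm (θ : k) (u₁ u₂ : KTwo k) :
    cyclicGen m θ u₁ u₂ 0 * cyclicGen m θ u₁ u₂ 1 =
      algebraMap k (KTwo k) θ • (cyclicGen m θ u₁ u₂ 1 * cyclicGen m θ u₁ u₂ 0) := by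
  have := RingQuot.mkAlgHom_rel (KTwo k) (CycRel.q_comm (k := k) (m := m) (θ := θ) (u₁ := u₁)
    (u₂ := u₂))
  rwa [map_mul, map_mul, map_mul, AlgHom.commutes, ← Algebra.smul_def] at this

theorem cyclicGen_pow_fst (θ : k) (u₁ u₂ : KTwo k) :
    cyclicGen m θ u₁ u₂ 0 ^ m = algebraMap _ _ u₁ := by
  have := RingQuot.mkAlgHom_rel (KTwo k) (CycRel.pow_one (k := k) (m := m) (θ := θ) (u₁ := u₁)
    (u₂ := u₂))
  rwa [map_pow, AlgHom.commutes] at this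

theorem cyclicGen_pow_snd (θ : k) (u₁ u₂ : KTwo k) :
    cyclicGen m θ u₁ u₂ 1 ^ m = algebraMap _ _ u₂ := by
  have := RingQuot.mkAlgHom_rel (KTwo k) (CycRel.pow_two (k := k) (m := m) (θ := θ) (u₁ := u₁)
    (u₂ := u₂))
  rwa [map_pow, AlgHom.commutes] at this

/-- A representation of the cyclic algebra on an extension `L` of `K_2` by a Kummer generator and a
twisted automorphism. -/
theorem nontrivial_cyclicAlg {θ : k} {u₁ u₂ : KTwo k} {L : Type*} [Field L] (φ : KTwo k →+* L)
    (τ : L →+* L) (hτφ : ∀ x, τ (φ x) = φ x) (hτm : τ^[m] = id) {s₁ s₂ : L} (hs₁ : s₁ ^ m = φ u₁)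
    (hs₂ : s₂ ^ m = φ u₂) (hτ₁ : φ (algebraMap k _ θ) * τ s₁ = s₁) (hτ₂ : τ s₂ = s₂) :
    Nontrivial (CyclicAlg k m θ u₁ u₂) := by
  let := φ.toAlgebra
  have hφ : ∀ (x : KTwo k) (l : L), x • l = φ x * l := fun _ _ => rfl
  let T : End (KTwo k) L :=
    { toFun := fun l => s₂ * τ l
      map_add' := fun a b => by rw [map_add, mul_add]
      map_smul' := fun x a => by
        rw [hφ, map_mul, hτφ, RingHom.id_apply, hφ, mul_left_comm] }
  have hT : ∀ (n : ℕ) (l : L), (T ^ n) l = s₂ ^ n * τ^[n] l := by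
    intro n
    induction n with
    | zero => simp
    | succ n ih =>
      intro l
      have h2 : τ^[n] s₂ = s₂ := Function.iterate_fixed hτ₂ n
      have h3 : T l = s₂ * τ l := rfl
      rw [pow_succ, Module.End.mul_apply, ih, h3, iterate_map_mul, h2, Function.iterate_succ_apply]
      ring
  refine RingHom.domain_nontrivial (RingQuot.liftAlgHom (KTwo k) ⟨FreeAlgebra.lift (KTwo k)
    ![LinearMap.mulLeft (KTwo k) s₁, T], ?_⟩ : CyclicAlg k m θ u₁ u₂ →ₐ[KTwo k]
      End (KTwo k) L).toRingHom
  rintro _ _ (_ | _ | _) <;> ext l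
  · have h3 : ∀ l, T l = s₂ * τ l := fun _ => rfl
    simp [h3, hφ]
    conv_lhs => rw [← hτ₁]
    ring
  · simp [LinearMap.pow_mulLeft, hs₁, hφ]
  · simp [hT, hτm, hs₂, hφ]

theorem gen_pow_mul_gen_pow_mem_span {K A : Type*} [Field K] [Ring A] [Algebra K A] {u₁ u₂ : K}
    {y₁ y₂ : Aˣ} (hm : 0 < m) (h₁ : (y₁ : A) ^ m = algebraMap K A u₁)
    (h₂ : (y₂ : A) ^ m = algebraMap K A u₂) (i j : ℕ) :
    (y₁ : A) ^ i * (y₂ : A) ^ j ∈ Submodule.span K (Set.range fun x : Fin m × Fin m =>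
      (quantumMonomial y₁ y₂ (boundedExponent x) : A)) := by
  have key : (y₁ : A) ^ i * (y₂ : A) ^ j =
      (u₁ ^ (i / m) * u₂ ^ (j / m)) • ((y₁ : A) ^ (i % m) * (y₂ : A) ^ (j % m)) := by
    conv_lhs => rw [← Nat.mod_add_div i m, ← Nat.mod_add_div j m]
    rw [pow_add, pow_add, pow_mul, pow_mul, h₁, h₂, ← map_pow, ← map_pow,
      ← Algebra.commutes (u₁ ^ _), ← Algebra.commutes (u₂ ^ _), ← Algebra.smul_def,
      ← Algebra.smul_def, smul_mul_smul_comm]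
  rw [key]
  refine Submodule.smul_mem _ _ (Submodule.subset_span
    ⟨(⟨i % m, Nat.mod_lt _ hm⟩, ⟨j % m, Nat.mod_lt _ hm⟩), ?_⟩)
  simp only [quantumMonomial, boundedExponent, zpow_natCast, Units.val_mul, Units.val_pow_eq_pow_val]

theorem isCyclicPair_of_adjoin_eq_top {K A : Type*} [Field K] [Ring A] [Algebra K A]
    {θ u₁ u₂ : Kˣ} {y₁ y₂ : Aˣ} (hθ : orderOf θ = m) (hm : 0 < m)
    (hcomm : (y₁ : A) * y₂ = (θ : K) • ((y₂ : A) * y₁)) (h₁ : (y₁ : A) ^ m = algebraMap K A u₁)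
    (h₂ : (y₂ : A) ^ m = algebraMap K A u₂) (hgen : Algebra.adjoin K {(y₁ : A), (y₂ : A)} = ⊤) :
    IsCyclicPair m θ u₁ u₂ y₁ y₂ := by
  refine ⟨hθ, hm, hcomm, h₁, h₂, ?_⟩
  set S := Submodule.span K (Set.range fun x : Fin m × Fin m =>
    (quantumMonomial y₁ y₂ (boundedExponent x) : A))
  have hmem := gen_pow_mul_gen_pow_mem_span hm h₁ h₂
  have hmul : ∀ a ∈ Algebra.adjoin K {(y₁ : A), (y₂ : A)}, ∀ b ∈ S, a * b ∈ S := by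
    intro a ha
    induction ha using Algebra.adjoin_induction with
    | mem a ha =>
      intro b hb
      induction hb using Submodule.span_induction with
      | mem b hb =>
        obtain ⟨x, rfl⟩ := hb
        simp only [quantumMonomial, boundedExponent, zpow_natCast, Units.val_mul,
          Units.val_pow_eq_pow_val]
        rcases ha with rfl | rfl
        · rw [← mul_assoc, ← pow_succ']
          exact hmem _ _
        · have := S.smul_mem ((θ : K) ^ (x.1 : ℕ))⁻¹ (hmem x.1 (x.2 + 1))
          rwa [pow_succ', ← mul_assoc, pow_mul_eq_smul_mul_pow hcomm, smul_mul_assoc,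
            inv_smul_smul₀ (pow_ne_zero _ θ.ne_zero), mul_assoc] at this
      | zero => rw [mul_zero]; exact S.zero_mem
      | add b c _ _ hb hc => rw [mul_add]; exact S.add_mem hb hc
      | smul c b _ hb => rw [mul_smul_comm]; exact S.smul_mem _ hb
    | algebraMap r =>
      intro b hb
      rw [← Algebra.smul_def]
      exact S.smul_mem _ hb
    | add a a' _ _ ha ha' => intro b hb; rw [add_mul]; exact S.add_mem (ha b hb) (ha' b hb)
    | mul a a' _ _ ha ha' => intro b hb; rw [mul_assoc]; exact ha _ (ha' b hb)
  refine Submodule.eq_top_iff'.mpr fun x => ?_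
  simpa using hmul x (hgen ▸ Algebra.mem_top) 1 (by simpa using hmem 0 0)

theorem adjoin_cyclicGen (θ : k) (u₁ u₂ : KTwo k) :
    Algebra.adjoin (KTwo k) {cyclicGen m θ u₁ u₂ 0, cyclicGen m θ u₁ u₂ 1} = ⊤ := by
  have h := congrArg (Subalgebra.map (RingQuot.mkAlgHom (KTwo k) (CycRel k m θ u₁ u₂)))
    (FreeAlgebra.adjoin_range_ι (KTwo k) (Fin 2))
  rw [AlgHom.map_adjoin, Algebra.map_top, (AlgHom.range_eq_top _).mpr
    (RingQuot.mkAlgHom_surjective _ _), ← Set.range_comp] at h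
  rw [← h]
  congr 1
  ext x
  simp [Fin.exists_fin_two, cyclicGen, eq_comm]

theorem exists_isCyclicPair (θ : kˣ) (hm : 0 < m) (hθ : orderOf θ = m) (u₁ u₂ : (KTwo k)ˣ) :
    ∃ y₁ y₂, IsCyclicPair (A := CyclicAlg k m (θ : k) (u₁ : KTwo k) u₂) m
      (Units.map (algebraMap k (KTwo k) : k →* KTwo k) θ) u₁ u₂ y₁ y₂ := by
  have hx : ∀ i, IsUnit (cyclicGen m (θ : k) (u₁ : KTwo k) u₂ i) := by
    intro i
    rw [← isUnit_pow_iff hm.ne']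
    fin_cases i
    · exact cyclicGen_pow_fst (m := m) (θ : k) (u₁ : KTwo k) u₂ ▸ u₁.isUnit.map _
    · exact cyclicGen_pow_snd (m := m) (θ : k) (u₁ : KTwo k) u₂ ▸ u₂.isUnit.map _
  refine ⟨(hx 0).unit, (hx 1).unit, isCyclicPair_of_adjoin_eq_top ?_ hm
    (cyclicGen_mul_comm _ _ _) (cyclicGen_pow_fst _ _ _) (cyclicGen_pow_snd _ _ _)
    (adjoin_cyclicGen _ _ _)⟩
  rw [← hθ]
  exact orderOf_injective (Units.map (algebraMap k (KTwo k) : k →* KTwo k))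
    (Units.map_injective (algebraMap k (KTwo k)).injective) θ

end CyclicAlgebra

section OrderOfClass

variable {k : Type*} [Field k] {m : ℕ}

/-- The variable `t_i` as a unit. -/
def tvUnit (k : Type*) [Field k] (i : Fin 2) : (KTwo k)ˣ := Units.mk0 (tv k i) (tv_ne_zero i)

theorem nontrivial_cyclicAlg_tv (θ : kˣ) (hm : 0 < m) (hθ : orderOf θ = m) :
    Nontrivial (CyclicAlg k m (θ : k) (tv k 0) (tv k 1)) := by
  have hθm : θ⁻¹ ^ m = 1 := by rw [inv_pow, ← hθ, pow_orderOf_eq_one, inv_one]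
  have hθm' : ((θ⁻¹ : kˣ) : k) ^ m = 1 := by rw [← Units.val_pow_eq_pow_val, hθm, Units.val_one]
  have hinj := MvPolynomial.expand_injective (σ := Fin 2) (R := k) hm
  have hpow : ∀ i, tv k i ^ m = fracMap (MvPolynomial.expand m) hinj (tv k i) := fun i => by
    rw [tv, fracMap_algebraMap, MvPolynomial.expand_X, map_pow]
  refine nontrivial_cyclicAlg (fracMap (MvPolynomial.expand m) hinj) (fracScale θ⁻¹)
    (fracMap_fracMap _ _ _ (scaleFst_comp_expand hθm')) (fracScale_iterate_eq_id hθm) (hpow 0)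
    (hpow 1) ?_ (fracScale_snd _)
  rw [fracMap_algebraMap_base, fracScale_fst, ← mul_assoc, ← map_mul, Units.mul_inv, map_one,
    one_mul]

theorem exists_isCyclicPair_tv (θ : kˣ) (hm : 0 < m) (hθ : orderOf θ = m) :
    ∃ y₁ y₂, IsCyclicPair (A := CyclicAlg k m (θ : k) (tv k 0) (tv k 1)) m
      (Units.map (algebraMap k (KTwo k) : k →* KTwo k) θ) (tvUnit k 0) (tvUnit k 1) y₁ y₂ :=
  exists_isCyclicPair θ hm hθ (tvUnit k 0) (tvUnit k 1)

/-- If the `r`-th tensor power of `(t₁, t₂; m, K_2, θ)` is split, then `m` divides `r`. -/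
theorem dvd_of_tensorPowSplit [CharZero k] (θ : kˣ) (hm : 0 < m) (hθ : orderOf θ = m) {r : ℕ}
    (hr : 0 < r) (hs : TensorPowSplit k (CyclicAlg k m (θ : k) (tv k 0) (tv k 1)) r) : m ∣ r := by
  have : CharZero (KTwo k) := charZero_of_injective_algebraMap (algebraMap k (KTwo k)).injective
  have hnt := nontrivial_cyclicAlg_tv θ hm hθ
  obtain ⟨y₁, y₂, h⟩ := exists_isCyclicPair_tv θ hm hθ
  obtain ⟨n, hn, ⟨ρ⟩⟩ := hs
  have hdim := ρ.toLinearEquiv.finrank_eq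
  have hdim' := (h.finrank_tensorPower (Fin r)).symm.trans hdim
  rw [finrank_matrix, Fintype.card_fin, Fintype.card_fin, finrank_self, mul_one, mul_pow] at hdim'
  have hnm : n = m ^ r := (Nat.mul_self_inj.mp hdim').symm
  have hθm : θ⁻¹ ^ m = 1 := by rw [inv_pow, ← hθ, pow_orderOf_eq_one, inv_one]
  have hθm' : ((θ⁻¹ : kˣ) : k) ^ m = 1 := by rw [← Units.val_pow_eq_pow_val, hθm, Units.val_one]
  set φ : KTwo k →+* KTwo k := fracMap (powFst k m) (powFst_injective hm) with hφ
  have hτφ : ∀ x, fracScale θ⁻¹ (φ x) = φ x := fracMap_fracMap _ _ _ (scaleFst_comp_powFst hθm')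
  let F : (⨂[KTwo k] _ : Fin r, CyclicAlg k m (θ : k) (tv k 0) (tv k 1)) →+*
      End (KTwo k) (Fin n → KTwo k) :=
    ((Matrix.toLinAlgEquiv' (R := KTwo k) (n := Fin n)) : _ →+* _).comp
      (φ.mapMatrix.comp (ρ : _ →+* Matrix (Fin n) (Fin n) (KTwo k)))
  have hFapp : ∀ b x, F b x = ((ρ b).map φ).mulVec x := fun _ _ => rfl
  obtain ⟨g, hg⟩ := h.exists_norm_eq (⟨0, hr⟩ : Fin r) φ (fracScale θ⁻¹) F
    (fun x b => by
      refine LinearMap.ext fun v => ?_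
      rw [LinearMap.smul_apply, hFapp, hFapp, map_smul, ← Matrix.smul_mulVec]
      congr 1
      ext i j
      simp)
    (fun v i => fracScale θ⁻¹ (v i)) (fun l v => funext fun i => by simp)
    (fun b v => funext fun i => by
      have hM : ((ρ b).map φ).map (fracScale θ⁻¹) = (ρ b).map φ := Matrix.ext fun i j => hτφ _
      rw [hFapp, hFapp, RingHom.map_mulVec, hM]
      rfl)
    (by
      have hit : ∀ (j : ℕ) (v : Fin n → KTwo k),
          (fun (v : Fin n → KTwo k) i => fracScale θ⁻¹ (v i))^[j] v =
            fun i => (fracScale θ⁻¹)^[j] (v i) := by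
        intro j
        induction j with
        | zero => intro v; rfl
        | succ j ih => intro v; simp only [Function.iterate_succ_apply, ih]
      funext v
      rw [hit, fracScale_iterate_eq_id hθm]
      rfl)
    (by simpa using hnm) (s := tv k 0)
    (by
      change _ = fracMap _ _ (tv k 0)
      rw [tv, fracMap_algebraMap]
      simp [powFst])
    (by
      rw [fracScale_fst, hφ]
      simp [fracMap_algebraMap_base])
  have hφt : φ (tvUnit k 1 : KTwo k) = tv k 1 := by
    change fracMap _ _ (tv k 1) = _
    rw [tv, fracMap_algebraMap]
    simp [powFst]
  rw [hφt, Fintype.card_fin] at hg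
  exact dvd_of_pow_eq_prod _ hm hg

end OrderOfClass

theorem statement17 (k : Type*) [Field k] [IsAlgClosed k] [CharZero k]
    (θ : kˣ) (m : ℕ) (hm : 0 < m) (hord : orderOf θ = m) :
    -- the cyclic algebra `(t_1, t_2; m, K_2, θ)` is a central simple `K_2`-algebra ...
    Algebra.IsCentral (KTwo k) (CyclicAlg k m (θ : k) (tv k 0) (tv k 1)) ∧
    IsSimpleRing (CyclicAlg k m (θ : k) (tv k 0) (tv k 1)) ∧
    FiniteDimensional (KTwo k) (CyclicAlg k m (θ : k) (tv k 0) (tv k 1)) ∧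
    -- ... whose class in the Brauer group `Br(K_2)` has order exactly `m`
    TensorPowSplit k (CyclicAlg k m (θ : k) (tv k 0) (tv k 1)) m ∧
    (∀ r : ℕ, 0 < r → r < m → ¬ TensorPowSplit k (CyclicAlg k m (θ : k) (tv k 0) (tv k 1)) r) := by
  have : CharZero (KTwo k) := charZero_of_injective_algebraMap (algebraMap k (KTwo k)).injective
  have hnt := nontrivial_cyclicAlg_tv θ hm hord
  obtain ⟨y₁, y₂, h⟩ := exists_isCyclicPair_tv θ hm hord
  exact ⟨h.isCentral, h.isSimpleRing, h.finiteDimensional,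
    ⟨m ^ m, pow_pos hm m, h.exists_algEquiv_matrix (Fintype.card_fin m)⟩, fun r hr hrm hs =>
      (Nat.le_of_dvd hr (dvd_of_tensorPowSplit θ hm hord hr hs)).not_gt hrm⟩
end
end

section
/- Let θ_1, θ_2 ∈ k^× have finite orders m_1, m_2 respectively. If the cyclic algebras (t_1, t_2; m_1, K_2, θ_1) and (t_1, t_2; m_2, K_2, θ_2) are isomorphic as K_2-algebras, then θ_1 = θ_2. (Equivalently: if the central localizations Q(θ_1) ⊗ K_2 and Q(θ_2) ⊗ K_2 of the quantum tori are K_2-isomorphic, then θ_1 = θ_2.) -/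
noncomputable section

open MvPolynomial

section TwistedProduct

variable {k : Type*} [Field k]

/-- The substitution `X₀ ↦ c X₀`, `X₁ ↦ X₁`. -/
def scale (c : k) : MvPolynomial (Fin 2) k →ₐ[k] MvPolynomial (Fin 2) k :=
  aeval ![C c * X 0, X 1]

lemma scale_monomial (c : k) (β : Fin 2 →₀ ℕ) (a : k) :
    scale c (monomial β a) = monomial β (c ^ β 0 * a) := by
  rw [scale, aeval_monomial, monomial_eq, Finsupp.prod_fintype _ _ (by simp),
    Finsupp.prod_fintype _ _ (by simp)]
  simp only [Fin.prod_univ_two, Matrix.cons_val_zero, Matrix.cons_val_one, mul_pow, map_mul,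
    map_pow, algebraMap_eq]
  ring

lemma coeff_scale (c : k) (q : MvPolynomial (Fin 2) k) (β : Fin 2 →₀ ℕ) :
    coeff β (scale c q) = c ^ β 0 * coeff β q := by
  classical
  induction q using MvPolynomial.induction_on' with
  | monomial α a =>
    rw [scale_monomial, coeff_monomial, coeff_monomial]
    split_ifs with h
    · rw [h]
    · simp
  | add p q hp hq => simp only [map_add, coeff_add, hp, hq, mul_add]

lemma scale_scale (c d : k) (q : MvPolynomial (Fin 2) k) :
    scale c (scale d q) = scale (c * d) q := by
  ext β
  simp only [coeff_scale, mul_pow, mul_assoc]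

lemma scale_one (q : MvPolynomial (Fin 2) k) : scale 1 q = q := by
  ext β
  simp [coeff_scale]

lemma scale_injective {c : k} (hc : c ≠ 0) : Function.Injective (scale c) := by
  intro p q h
  simpa [scale_scale, inv_mul_cancel₀ hc, scale_one] using congrArg (scale c⁻¹) h

/-- The product of the quantum plane `X₀ X₁ = η⁻¹ X₁ X₀`, carried on commutative polynomials by
identifying normally ordered monomials with commutative ones: `X₁` acts on the polynomials to its
right by the substitution `X₀ ↦ η X₀` followed by multiplication by `X₁`. -/
def twistedMul (η : k) : MvPolynomial (Fin 2) k →ₗ[k] Module.End k (MvPolynomial (Fin 2) k) :=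
  (basisMonomials (Fin 2) k).constr k fun α =>
    (LinearMap.mulLeft k (monomial α 1)) ∘ₗ (scale (η ^ α 1)).toLinearMap

lemma twistedMul_monomial (η : k) (α : Fin 2 →₀ ℕ) (c : k) (q : MvPolynomial (Fin 2) k) :
    twistedMul η (monomial α c) q = monomial α c * scale (η ^ α 1) q := by
  have h : monomial α c = c • basisMonomials (Fin 2) k α := by
    simp [smul_monomial]
  rw [h, map_smul, twistedMul, Module.Basis.constr_basis]
  simp

lemma twistedMul_apply (η : k) (p q : MvPolynomial (Fin 2) k) :
    twistedMul η p q = ∑ α ∈ p.support, monomial α (coeff α p) * scale (η ^ α 1) q := by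
  conv_lhs => rw [p.as_sum]
  simp only [map_sum, LinearMap.sum_apply, twistedMul_monomial]

lemma twistedMul_assoc (η : k) (p q r : MvPolynomial (Fin 2) k) :
    twistedMul η (twistedMul η p q) r = twistedMul η p (twistedMul η q r) := by
  induction p using MvPolynomial.induction_on' with
  | add p p' hp hp' => simp only [map_add, LinearMap.add_apply, hp, hp']
  | monomial α a =>
    induction q using MvPolynomial.induction_on' with
    | add q q' hq hq' => simp only [map_add, LinearMap.add_apply, hq, hq']
    | monomial β b =>
      simp only [twistedMul_monomial, scale_monomial, monomial_mul, map_mul, scale_scale,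
        Finsupp.add_apply, pow_add, ← mul_assoc]

lemma twistedMul_one (η : k) (p : MvPolynomial (Fin 2) k) : twistedMul η p 1 = p := by
  rw [twistedMul_apply]
  simp only [map_one, mul_one]
  exact p.as_sum.symm

lemma twistedMul_expand {η : k} {m : ℕ} (hη : η ^ m = 1) (s q : MvPolynomial (Fin 2) k) :
    twistedMul η (expand m s) q = expand m s * q := by
  induction s using MvPolynomial.induction_on' with
  | add p p' hp hp' => simp only [map_add, LinearMap.add_apply, hp, hp', add_mul]
  | monomial α a =>
    rw [expand_monomial, twistedMul_monomial]
    simp [pow_mul, hη, scale_one]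

open scoped MonomialOrder

lemma coeff_twistedMul_of_le (o : MonomialOrder (Fin 2)) (η : k) (p q : MvPolynomial (Fin 2) k)
    {γ : Fin 2 →₀ ℕ} (hγ : o.degree p + o.degree q ≼[o] γ) :
    coeff γ (twistedMul η p q) = if γ = o.degree p + o.degree q then
      o.leadingCoeff p * o.leadingCoeff q * η ^ (o.degree p 1 * o.degree q 0) else 0 := by
  classical
  have key : ∀ α ∈ p.support, ∀ δ, α + δ = γ → coeff δ q ≠ 0 →
      α = o.degree p ∧ δ = o.degree q := by
    intro α hα δ hαδ hδ
    have h1 := o.le_degree hα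
    have h2 := o.le_degree (mem_support_iff.mpr hδ)
    rw [← hαδ, map_add, map_add] at hγ
    have h3 : o.toSyn α = o.toSyn (o.degree p) := by
      refine le_antisymm h1 (not_lt.mp fun h => ?_)
      exact absurd (lt_of_le_of_lt hγ (add_lt_add_of_lt_of_le h h2)) (lt_irrefl _)
    have h4 : o.toSyn δ = o.toSyn (o.degree q) := by
      rw [h3] at hγ
      exact le_antisymm h2 (le_of_add_le_add_left hγ)
    exact ⟨o.toSyn.injective h3, o.toSyn.injective h4⟩
  have hterm : ∀ α ∈ p.support, α ≠ o.degree p ∨ γ ≠ o.degree p + o.degree q →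
      coeff γ (monomial α (coeff α p) * scale (η ^ α 1) q) = 0 := by
    intro α hα h
    rw [coeff_monomial_mul']
    split_ifs with hle
    · rw [coeff_scale]
      by_contra hne
      have hsum := add_tsub_cancel_of_le hle
      obtain ⟨h1, h2⟩ := key α hα (γ - α) hsum (by
        intro h0
        simp [h0] at hne)
      rcases h with h | h
      · exact h h1
      · exact h (by rw [← hsum, h2, ← h1])
    · rfl
  rw [twistedMul_apply, coeff_sum]
  split_ifs with h
  · rw [Finset.sum_eq_single (o.degree p)]
    · rw [h, coeff_monomial_mul, coeff_scale, MonomialOrder.leadingCoeff,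
        MonomialOrder.leadingCoeff, pow_mul]
      ring
    · intro α hα hne
      exact hterm α hα (Or.inl hne)
    · intro h0
      rw [notMem_support_iff.mp h0]
      simp
  · exact Finset.sum_eq_zero fun α hα => hterm α hα (Or.inr h)

lemma twistedMul_leading (o : MonomialOrder (Fin 2)) {η : k} (hη : η ≠ 0)
    {p q : MvPolynomial (Fin 2) k} (hp : p ≠ 0) (hq : q ≠ 0) :
    twistedMul η p q ≠ 0 ∧ o.degree (twistedMul η p q) = o.degree p + o.degree q ∧
      o.leadingCoeff (twistedMul η p q) =
        o.leadingCoeff p * o.leadingCoeff q * η ^ (o.degree p 1 * o.degree q 0) := by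
  have h1 := coeff_twistedMul_of_le o η p q le_rfl
  rw [if_pos rfl] at h1
  have h2 : coeff (o.degree p + o.degree q) (twistedMul η p q) ≠ 0 := by
    rw [h1]
    exact mul_ne_zero (mul_ne_zero (o.leadingCoeff_ne_zero_iff.mpr hp)
      (o.leadingCoeff_ne_zero_iff.mpr hq)) (pow_ne_zero _ hη)
  have h3 : twistedMul η p q ≠ 0 := by
    rintro h
    simp [h] at h2
  have h4 : o.degree (twistedMul η p q) = o.degree p + o.degree q := by
    have hle := o.le_degree (mem_support_iff.mpr h2)
    by_contra hne
    refine o.coeff_degree_ne_zero_iff.mpr h3 ?_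
    rw [coeff_twistedMul_of_le o η p q hle, if_neg hne]
  refine ⟨h3, h4, ?_⟩
  rw [← h1, MonomialOrder.leadingCoeff, h4]

lemma twistedMul_pow_one_leading (o : MonomialOrder (Fin 2)) {η : k} (hη : η ≠ 0)
    {p : MvPolynomial (Fin 2) k} (hp : p ≠ 0) (n : ℕ) :
    (twistedMul η p ^ n) 1 ≠ 0 ∧ o.degree ((twistedMul η p ^ n) 1) = n • o.degree p := by
  induction n with
  | zero => simp
  | succ n ih =>
    rw [pow_succ', Module.End.mul_apply]
    obtain ⟨h1, h2, -⟩ := twistedMul_leading o hη hp ih.1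
    exact ⟨h1, by rw [h2, ih.2, succ_nsmul']⟩

lemma dvd_degree_expand (o : MonomialOrder (Fin 2)) {m : ℕ} (hm : 0 < m)
    {s : MvPolynomial (Fin 2) k} (hs : s ≠ 0) (i : Fin 2) : m ∣ o.degree (expand m s) i := by
  by_contra h
  exact o.coeff_degree_ne_zero_iff.mpr ((expand_ne_zero hm).mpr hs) (coeff_expand_of_not_dvd _ h)

end TwistedProduct

section Representation

variable {k : Type*} [Field k]

/-- The image of the `i`-th generator in the cyclic algebra. -/
def cycGen (m : ℕ) (θ : k) (u₁ u₂ : KTwo k) (i : Fin 2) : CyclicAlg k m θ u₁ u₂ :=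
  RingQuot.mkAlgHom (KTwo k) _ (FreeAlgebra.ι (KTwo k) i)

lemma cycGen_comm (m : ℕ) (θ : k) (u₁ u₂ : KTwo k) :
    cycGen m θ u₁ u₂ 0 * cycGen m θ u₁ u₂ 1 =
      algebraMap (KTwo k) _ (algebraMap k (KTwo k) θ) *
        (cycGen m θ u₁ u₂ 1 * cycGen m θ u₁ u₂ 0) := by
  simpa [cycGen] using RingQuot.mkAlgHom_rel (KTwo k) (CycRel.q_comm (m := m) (θ := θ)
    (u₁ := u₁) (u₂ := u₂))

lemma cycGen_zero_pow (m : ℕ) (θ : k) (u₁ u₂ : KTwo k) :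
    cycGen m θ u₁ u₂ 0 ^ m = algebraMap (KTwo k) _ u₁ := by
  simpa [cycGen] using RingQuot.mkAlgHom_rel (KTwo k) (CycRel.pow_one (m := m) (θ := θ)
    (u₁ := u₁) (u₂ := u₂))

lemma cycGen_one_pow (m : ℕ) (θ : k) (u₁ u₂ : KTwo k) :
    cycGen m θ u₁ u₂ 1 ^ m = algebraMap (KTwo k) _ u₂ := by
  simpa [cycGen] using RingQuot.mkAlgHom_rel (KTwo k) (CycRel.pow_two (m := m) (θ := θ)
    (u₁ := u₁) (u₂ := u₂))

lemma CyclicAlg.induction {m : ℕ} {θ : k} {u₁ u₂ : KTwo k}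
    {P : CyclicAlg k m θ u₁ u₂ → Prop}
    (scalar : ∀ c, P (algebraMap (KTwo k) _ c)) (gen : ∀ i, P (cycGen m θ u₁ u₂ i))
    (mul : ∀ a b, P a → P b → P (a * b)) (add : ∀ a b, P a → P b → P (a + b))
    (a : CyclicAlg k m θ u₁ u₂) : P a := by
  obtain ⟨x, rfl⟩ := RingQuot.mkAlgHom_surjective (KTwo k) (CycRel k m θ u₁ u₂) a
  induction x with
  | grade0 r => simpa using scalar r
  | grade1 i => exact gen i
  | mul a b ha hb => simpa using mul _ _ ha hb
  | add a b ha hb => simpa using add _ _ ha hb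

/-- Given an extension field `F` of `KTwo k` with an automorphism `τ` over `KTwo k`, the cyclic
algebra acts on `F` by multiplication by `Y₁` and by `Y₂ τ`. -/
lemma CyclicAlg.exists_action {F : Type*} [Field F] (j : KTwo k →+* F) (τ : F →+* F)
    (Y₁ Y₂ : F) {m : ℕ} {θ : k} {u₁ u₂ : KTwo k} (hτj : ∀ c, τ (j c) = j c)
    (hτm : ∀ f, τ^[m] f = f) (hY₁ : Y₁ = j (algebraMap k _ θ) * τ Y₁) (hY₂ : τ Y₂ = Y₂)
    (hu₁ : Y₁ ^ m = j u₁) (hu₂ : Y₂ ^ m = j u₂) :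
    ∃ ρ : CyclicAlg k m θ u₁ u₂ →+* AddMonoid.End F,
      (∀ c f, ρ (algebraMap (KTwo k) _ c) f = j c * f) ∧
      (∀ f, ρ (cycGen m θ u₁ u₂ 0) f = Y₁ * f) ∧
      (∀ f, ρ (cycGen m θ u₁ u₂ 1) f = Y₂ * τ f) := by
  let := j.toAlgebra
  have hj : ∀ c, algebraMap (KTwo k) F c = j c := fun c => rfl
  let τ' : F →ₐ[KTwo k] F := { τ with commutes' := hτj }
  let T : Fin 2 → Module.End (KTwo k) F :=
    ![LinearMap.mulLeft _ Y₁, (LinearMap.mulLeft _ Y₂) ∘ₗ τ'.toLinearMap]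
  have hT0 : ∀ f, T 0 f = Y₁ * f := fun f => rfl
  have hT1 : ∀ f, T 1 f = Y₂ * τ f := fun f => rfl
  have hp0 : ∀ n f, (T 0 ^ n) f = Y₁ ^ n * f := by
    intro n f
    induction n with
    | zero => simp
    | succ n ih => rw [pow_succ', Module.End.mul_apply, ih, hT0]; ring
  have hp1 : ∀ n f, (T 1 ^ n) f = Y₂ ^ n * τ^[n] f := by
    intro n f
    induction n with
    | zero => simp
    | succ n ih =>
      rw [pow_succ', Module.End.mul_apply, ih, hT1, Function.iterate_succ_apply', map_mul,
        map_pow, hY₂]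
      ring
  let g : CyclicAlg k m θ u₁ u₂ →ₐ[KTwo k] Module.End (KTwo k) F :=
    RingQuot.liftAlgHom (KTwo k) ⟨FreeAlgebra.lift (KTwo k) T, by
      intro x y h
      cases h with
      | q_comm =>
        ext f
        simp only [map_mul, FreeAlgebra.lift_ι_apply, AlgHom.commutes, Module.End.mul_apply,
          hT0, hT1, Module.algebraMap_end_apply, Algebra.smul_def, hj]
        nth_rewrite 1 [hY₁]
        ring
      | pow_one =>
        ext f
        simp only [map_pow, FreeAlgebra.lift_ι_apply, AlgHom.commutes, hp0,
          Module.algebraMap_end_apply, Algebra.smul_def, hj, hu₁]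
      | pow_two =>
        ext f
        simp only [map_pow, FreeAlgebra.lift_ι_apply, AlgHom.commutes, hp1,
          Module.algebraMap_end_apply, Algebra.smul_def, hj, hu₂, hτm]⟩
  have hg : ∀ i, g (cycGen m θ u₁ u₂ i) = T i := by
    intro i
    simp only [g, cycGen]
    rw [RingQuot.liftAlgHom_mkAlgHom_apply, FreeAlgebra.lift_ι_apply]
  refine ⟨(Module.toAddMonoidEnd (Module.End (KTwo k) F) F).comp g.toRingHom, ?_, ?_, ?_⟩
  · intro c f
    change g (algebraMap (KTwo k) _ c) f = _
    rw [AlgHom.commutes, Module.algebraMap_end_apply, Algebra.smul_def, hj]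
  · intro f
    change g (cycGen m θ u₁ u₂ 0) f = _
    rw [hg, hT0]
  · intro f
    change g (cycGen m θ u₁ u₂ 1) f = _
    rw [hg, hT1]

/-- The cyclic algebra `(t₁, t₂; m, K₂, θ)` acts on `k(Y₁, Y₂)`, where `tᵢ` acts as
multiplication by `Yᵢᵐ`. -/
lemma CyclicAlg.exists_action_KTwo {m : ℕ} (hm : 0 < m) {θ : k} (hθ : θ ^ m = 1) :
    ∃ ρ : CyclicAlg k m θ (tv k 0) (tv k 1) →+* AddMonoid.End (KTwo k),
      (∀ n f, ρ (algebraMap (KTwo k) _ (algebraMap (MvPolynomial (Fin 2) k) _ n)) f =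
        algebraMap (MvPolynomial (Fin 2) k) _ (expand m n) * f) ∧
      ∀ i (q : MvPolynomial (Fin 2) k),
        ρ (cycGen m θ (tv k 0) (tv k 1) i) (algebraMap _ _ q) =
          algebraMap _ _ (twistedMul θ⁻¹ (X i) q) := by
  have hθ0 : θ ≠ 0 := by
    rintro rfl
    simp [hm.ne'] at hθ
  have hinj := IsFractionRing.injective (MvPolynomial (Fin 2) k) (KTwo k)
  have hsinj := scale_injective (inv_ne_zero hθ0)
  let e : MvPolynomial (Fin 2) k →+* KTwo k :=
    (algebraMap _ (KTwo k)).comp (expand m).toRingHom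
  have he : Function.Injective e := hinj.comp (expand_injective hm)
  let j : KTwo k →+* KTwo k := IsFractionRing.lift he
  let e' : MvPolynomial (Fin 2) k →+* KTwo k :=
    (algebraMap _ (KTwo k)).comp (scale θ⁻¹).toRingHom
  have he' : Function.Injective e' := hinj.comp hsinj
  let τ : KTwo k →+* KTwo k := IsFractionRing.lift he'
  have hj : ∀ s, j (algebraMap _ _ s) = algebraMap (MvPolynomial (Fin 2) k) _ (expand m s) :=
    fun s => IsFractionRing.lift_algebraMap he s
  have hτ : ∀ s, τ (algebraMap _ _ s) = algebraMap (MvPolynomial (Fin 2) k) _ (scale θ⁻¹ s) :=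
    fun s => IsFractionRing.lift_algebraMap he' s
  have hsm : ∀ n q, (scale θ⁻¹)^[n] q = scale (θ⁻¹ ^ n) q := by
    intro n q
    induction n with
    | zero => simp [scale_one]
    | succ n ih => rw [Function.iterate_succ_apply', ih, scale_scale, pow_succ']
  have hse : ∀ s, scale θ⁻¹ (expand m s) = expand m s := by
    intro s
    have h : (scale θ⁻¹).comp (expand m) = expand m := by
      ext i : 1
      fin_cases i <;> simp [scale, mul_pow, ← C_pow, hθ]
    exact DFunLike.congr_fun h s
  have hτj : ∀ c, τ (j c) = j c := by
    intro c
    obtain ⟨a, b, -, rfl⟩ := IsFractionRing.div_surjective (A := MvPolynomial (Fin 2) k) c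
    simp only [map_div₀, hj, hτ, hse]
  have hτn : ∀ n s, τ^[n] (algebraMap _ _ s) =
      algebraMap (MvPolynomial (Fin 2) k) _ ((scale θ⁻¹)^[n] s) := by
    intro n s
    induction n with
    | zero => rfl
    | succ n ih => rw [Function.iterate_succ_apply', Function.iterate_succ_apply', ih, hτ]
  have hτm : ∀ f, τ^[m] f = f := by
    intro f
    obtain ⟨a, b, -, rfl⟩ := IsFractionRing.div_surjective (A := MvPolynomial (Fin 2) k) f
    rw [← RingHom.coe_pow, map_div₀, RingHom.coe_pow]
    simp only [hτn, hsm, inv_pow, hθ, inv_one, scale_one]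
  have hs0 : scale θ⁻¹ (X 0) = C θ⁻¹ * X 0 := by simp [scale]
  have hs1 : scale θ⁻¹ (X 1) = X 1 := by simp [scale]
  obtain ⟨ρ, h1, h2, h3⟩ := CyclicAlg.exists_action (m := m) (θ := θ) (u₁ := tv k 0)
    (u₂ := tv k 1) j τ (tv k 0) (tv k 1) hτj hτm
    (by
      rw [IsScalarTower.algebraMap_apply k (MvPolynomial (Fin 2) k) (KTwo k), hj, tv, hτ, hs0,
        ← map_mul, algebraMap_eq, expand_C, ← mul_assoc, ← C_mul, mul_inv_cancel₀ hθ0, C_1,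
        one_mul])
    (by rw [tv, hτ, hs1]) (by rw [tv, hj, expand_X, map_pow]) (by rw [tv, hj, expand_X, map_pow])
  refine ⟨ρ, fun n f => by rw [h1, hj], fun i q => ?_⟩
  have hX : ∀ i, twistedMul θ⁻¹ (X i) q =
      X i * scale (θ⁻¹ ^ (Finsupp.single i 1 : Fin 2 →₀ ℕ) 1) q :=
    fun i => twistedMul_monomial _ _ _ _
  rw [hX]
  fin_cases i
  · simpa [scale_one, tv] using h2 (algebraMap _ _ q)
  · simpa [hτ, tv] using h3 (algebraMap _ _ q)

lemma map_mul_end_apply {A F : Type*} [Semiring A] [AddCommMonoid F]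
    (ρ : A →+* AddMonoid.End F) (a b : A) (f : F) : ρ (a * b) f = ρ a (ρ b f) := by
  rw [map_mul]
  rfl

lemma map_add_end_apply {A F : Type*} [Semiring A] [AddCommMonoid F]
    (ρ : A →+* AddMonoid.End F) (a b : A) (f : F) : ρ (a + b) f = ρ a f + ρ b f := by
  rw [map_add]
  rfl

lemma CyclicAlg.expand_mul_action {m : ℕ} {θ : k}
    {ρ : CyclicAlg k m θ (tv k 0) (tv k 1) →+* AddMonoid.End (KTwo k)}
    (hρ : ∀ n f, ρ (algebraMap (KTwo k) _ (algebraMap (MvPolynomial (Fin 2) k) _ n)) f =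
        algebraMap (MvPolynomial (Fin 2) k) _ (expand m n) * f)
    (a : CyclicAlg k m θ (tv k 0) (tv k 1)) (s : MvPolynomial (Fin 2) k) (f : KTwo k) :
    algebraMap _ (KTwo k) (expand m s) * ρ a f =
      ρ a (algebraMap _ (KTwo k) (expand m s) * f) := by
  rw [← hρ, ← hρ, ← map_mul_end_apply, ← map_mul_end_apply, Algebra.commutes]

/-- Elements of the cyclic algebra act, up to a denominator from `k[t₁, t₂]`, by twisted
multiplication by a polynomial. -/
lemma CyclicAlg.exists_denominator {m : ℕ} {θ : k} (hθ : θ ^ m = 1)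
    {ρ : CyclicAlg k m θ (tv k 0) (tv k 1) →+* AddMonoid.End (KTwo k)}
    (hρ : ∀ n f, ρ (algebraMap (KTwo k) _ (algebraMap (MvPolynomial (Fin 2) k) _ n)) f =
        algebraMap (MvPolynomial (Fin 2) k) _ (expand m n) * f)
    (hρgen : ∀ i (q : MvPolynomial (Fin 2) k),
        ρ (cycGen m θ (tv k 0) (tv k 1) i) (algebraMap _ _ q) =
          algebraMap _ _ (twistedMul θ⁻¹ (X i) q))
    (a : CyclicAlg k m θ (tv k 0) (tv k 1)) :
    ∃ s p : MvPolynomial (Fin 2) k, s ≠ 0 ∧ ∀ q : MvPolynomial (Fin 2) k,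
      algebraMap _ (KTwo k) (expand m s) * ρ a (algebraMap _ _ q) =
        algebraMap _ _ (twistedMul θ⁻¹ p q) := by
  have hη : θ⁻¹ ^ m = 1 := by simp [hθ]
  have hcomm := CyclicAlg.expand_mul_action hρ
  induction a using CyclicAlg.induction with
  | scalar c =>
    obtain ⟨a, b, hb, rfl⟩ := IsFractionRing.div_surjective (A := MvPolynomial (Fin 2) k) c
    have hb0 : b ≠ 0 := nonZeroDivisors.ne_zero hb
    have hb1 : algebraMap _ (KTwo k) b ≠ 0 := by simpa using hb0
    refine ⟨b, expand m a, hb0, fun q => ?_⟩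
    rw [← hρ, ← map_mul_end_apply, ← map_mul, mul_div_cancel₀ _ hb1, hρ,
      twistedMul_expand hη, map_mul]
  | gen i => exact ⟨1, X i, one_ne_zero, fun q => by rw [map_one, map_one, one_mul, hρgen]⟩
  | mul a b ha hb =>
    obtain ⟨s, p, hs, h⟩ := ha
    obtain ⟨s', p', hs', h'⟩ := hb
    refine ⟨s * s', twistedMul θ⁻¹ p p', mul_ne_zero hs hs', fun q => ?_⟩
    rw [map_mul, map_mul, map_mul_end_apply, mul_assoc, hcomm a s', h', h,
      twistedMul_assoc]
  | add a b ha hb =>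
    obtain ⟨s, p, hs, h⟩ := ha
    obtain ⟨s', p', hs', h'⟩ := hb
    refine ⟨s * s', expand m s' * p + expand m s * p', mul_ne_zero hs hs', fun q => ?_⟩
    rw [map_add_end_apply, ← twistedMul_expand hη, ← twistedMul_expand hη, map_add,
      LinearMap.add_apply, twistedMul_assoc, twistedMul_assoc, twistedMul_expand hη, twistedMul_expand hη, map_add,
      map_mul (algebraMap _ (KTwo k)), map_mul (algebraMap _ (KTwo k)), ← h, ← h', map_mul,
      map_mul]
    ring

/-- If `a ^ n = tᵢ` in the cyclic algebra, the degree of a numerator of `a` exceeds that of its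
denominator by `(m / n)` times the `i`-th unit vector. -/
lemma CyclicAlg.degree_numerator_of_pow_eq (o : MonomialOrder (Fin 2)) {m : ℕ} (hm : 0 < m)
    {θ : k} (hθ : θ ^ m = 1)
    {ρ : CyclicAlg k m θ (tv k 0) (tv k 1) →+* AddMonoid.End (KTwo k)}
    (hρ : ∀ n f, ρ (algebraMap (KTwo k) _ (algebraMap (MvPolynomial (Fin 2) k) _ n)) f =
        algebraMap (MvPolynomial (Fin 2) k) _ (expand m n) * f)
    {a : CyclicAlg k m θ (tv k 0) (tv k 1)} {n : ℕ} (hn : 0 < n) {i : Fin 2}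
    (ha : a ^ n = algebraMap (KTwo k) _ (tv k i))
    {s p : MvPolynomial (Fin 2) k} (hs : s ≠ 0) (h : ∀ q : MvPolynomial (Fin 2) k,
      algebraMap _ (KTwo k) (expand m s) * ρ a (algebraMap _ _ q) =
        algebraMap _ _ (twistedMul θ⁻¹ p q)) :
    p ≠ 0 ∧ n • o.degree p = n • o.degree (expand m s) + Finsupp.single i m := by
  have hθ0 : θ ≠ 0 := by
    rintro rfl
    simp [hm.ne'] at hθ
  have hinj := IsFractionRing.injective (MvPolynomial (Fin 2) k) (KTwo k)
  have hcomm := CyclicAlg.expand_mul_action hρ a s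
  have hpow : ∀ l : ℕ, algebraMap _ (KTwo k) (expand m s) ^ l * ρ (a ^ l) 1 =
      algebraMap _ _ ((twistedMul θ⁻¹ p ^ l) 1) := by
    intro l
    induction l with
    | zero => simp
    | succ l ih =>
      have hcomm' : ∀ (l : ℕ) (f : KTwo k), algebraMap _ (KTwo k) (expand m s) ^ l * ρ a f =
          ρ a (algebraMap _ (KTwo k) (expand m s) ^ l * f) := by
        intro l f
        induction l generalizing f with
        | zero => simp
        | succ l ih => rw [pow_succ, mul_assoc, hcomm, ih, mul_assoc]
      rw [pow_succ' (twistedMul θ⁻¹ p), Module.End.mul_apply, ← h, ← ih, pow_succ' a,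
        map_mul_end_apply, pow_succ', mul_assoc, hcomm' l]
  have heq : (twistedMul θ⁻¹ p ^ n) 1 = expand m s ^ n * X i ^ m := by
    apply hinj
    rw [← hpow, ha, show tv k i = algebraMap _ _ (X i) from rfl, hρ, expand_X, mul_one, map_mul,
      map_pow, map_pow]
  have hes : expand m s ≠ 0 := (expand_ne_zero hm).mpr hs
  have hX : (X i ^ m : MvPolynomial (Fin 2) k) ≠ 0 := pow_ne_zero _ (X_ne_zero i)
  have hp : p ≠ 0 := by
    rintro rfl
    rw [map_zero, zero_pow hn.ne', LinearMap.zero_apply] at heq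
    exact mul_ne_zero (pow_ne_zero n hes) hX heq.symm
  refine ⟨hp, ?_⟩
  rw [← (twistedMul_pow_one_leading o (inv_ne_zero hθ0) hp n).2, heq,
    o.degree_mul (pow_ne_zero n hes) hX, o.degree_pow, o.degree_pow, o.degree_X]
  simp

lemma CyclicAlg.eq_of_relations {m : ℕ} (hm : 0 < m) {θ : k} (hθ : θ ^ m = 1) {n : ℕ}
    (hn : 0 < n) {θ' : k} {a b : CyclicAlg k m θ (tv k 0) (tv k 1)}
    (hab : a * b = algebraMap (KTwo k) _ (algebraMap k (KTwo k) θ') * (b * a))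
    (ha : a ^ n = algebraMap (KTwo k) _ (tv k 0)) (hb : b ^ n = algebraMap (KTwo k) _ (tv k 1)) :
    n ∣ m ∧ (n = m → θ' = θ) := by
  have hθ0 : θ ≠ 0 := by
    rintro rfl
    simp [hm.ne'] at hθ
  have hinj := IsFractionRing.injective (MvPolynomial (Fin 2) k) (KTwo k)
  let o : MonomialOrder (Fin 2) := MonomialOrder.lex
  obtain ⟨ρ, hρ, hρgen⟩ := CyclicAlg.exists_action_KTwo hm hθ
  obtain ⟨s, p, hs, hp⟩ := CyclicAlg.exists_denominator hθ hρ hρgen a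
  obtain ⟨r, q, hr, hq⟩ := CyclicAlg.exists_denominator hθ hρ hρgen b
  obtain ⟨hp0, hdp⟩ := CyclicAlg.degree_numerator_of_pow_eq o hm hθ hρ hn ha hs hp
  obtain ⟨hq0, hdq⟩ := CyclicAlg.degree_numerator_of_pow_eq o hm hθ hρ hn hb hr hq
  have hcomm := CyclicAlg.expand_mul_action hρ
  have hp1 := DFunLike.congr_fun hdp 0
  have hp2 := DFunLike.congr_fun hdp 1
  have hq1 := DFunLike.congr_fun hdq 0
  have hq2 := DFunLike.congr_fun hdq 1
  simp only [Finsupp.smul_apply, Finsupp.add_apply, smul_eq_mul, Finsupp.single_eq_same] at hp1 hq2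
  have hp2' : o.degree p 1 = o.degree (expand m s) 1 := by
    simpa [hn.ne'] using hp2
  have hq1' : o.degree q 0 = o.degree (expand m r) 0 := by
    simpa [hn.ne'] using hq1
  refine ⟨(Nat.dvd_add_right (dvd_mul_right _ _)).mp (hp1 ▸ dvd_mul_right n _), ?_⟩
  rintro rfl
  have hp1' : o.degree p 0 = o.degree (expand n s) 0 + 1 :=
    Nat.eq_of_mul_eq_mul_left hn (by rw [hp1]; ring)
  have hq2' : o.degree q 1 = o.degree (expand n r) 1 + 1 :=
    Nat.eq_of_mul_eq_mul_left hn (by rw [hq2]; ring)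
  have hpq : twistedMul θ⁻¹ p q = C θ' * twistedMul θ⁻¹ q p := by
    apply hinj
    have hp' : algebraMap _ (KTwo k) (expand n s) * ρ a 1 = algebraMap _ _ p := by
      simpa [twistedMul_one] using hp 1
    have hq' : algebraMap _ (KTwo k) (expand n r) * ρ b 1 = algebraMap _ _ q := by
      simpa [twistedMul_one] using hq 1
    have hθ' : ρ (algebraMap (KTwo k) _ (algebraMap k (KTwo k) θ')) =
        ρ (algebraMap (KTwo k) _ (algebraMap (MvPolynomial (Fin 2) k) _ (C θ'))) := by
      rw [IsScalarTower.algebraMap_apply k (MvPolynomial (Fin 2) k) (KTwo k), algebraMap_eq]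
    rw [map_mul, ← hp, ← hq, ← hq', ← hp', ← hcomm a, ← hcomm b, ← map_mul_end_apply,
      ← map_mul_end_apply, hab, map_mul_end_apply, hθ', hρ, expand_C]
    ring
  have hlc := congrArg o.leadingCoeff hpq
  rw [o.leadingCoeff_mul, o.leadingCoeff_C,
    (twistedMul_leading o (inv_ne_zero hθ0) hp0 hq0).2.2,
    (twistedMul_leading o (inv_ne_zero hθ0) hq0 hp0).2.2] at hlc
  have hη : θ⁻¹ ^ n = 1 := by simp [hθ]
  have hpow : ∀ l, n ∣ l → θ⁻¹ ^ l = 1 := by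
    rintro _ ⟨c, rfl⟩
    rw [pow_mul, hη, one_pow]
  have hds := dvd_degree_expand o hm hs
  have hdr := dvd_degree_expand o hm hr
  rw [hpow _ (hp2' ▸ Dvd.dvd.mul_right (hds 1) _), hq2', hp1', mul_one,
    add_mul, one_mul, pow_add, hpow _ (Dvd.dvd.mul_right (hdr 1) _), one_mul, pow_succ,
    hpow _ (hds 0), one_mul] at hlc
  have hl : o.leadingCoeff p * o.leadingCoeff q ≠ 0 :=
    mul_ne_zero (o.leadingCoeff_ne_zero_iff.mpr hp0) (o.leadingCoeff_ne_zero_iff.mpr hq0)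
  have h1 : θ' * θ⁻¹ = 1 := by
    apply mul_left_cancel₀ hl
    rw [mul_one]
    nth_rewrite 2 [hlc]
    ring
  field_simp at h1
  exact h1

lemma CyclicAlg.eq_of_algEquiv {m n : ℕ} (hm : 0 < m) (hn : 0 < n) {θ θ' : k} (hθ : θ ^ m = 1)
    (e : CyclicAlg k n θ' (tv k 0) (tv k 1) ≃ₐ[KTwo k] CyclicAlg k m θ (tv k 0) (tv k 1)) :
    n ∣ m ∧ (n = m → θ' = θ) := by
  refine CyclicAlg.eq_of_relations hm hθ hn (a := e (cycGen _ _ _ _ 0))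
    (b := e (cycGen _ _ _ _ 1)) ?_ ?_ ?_
  · rw [← map_mul, cycGen_comm, map_mul, map_mul, AlgEquiv.commutes]
  · rw [← map_pow, cycGen_zero_pow, AlgEquiv.commutes]
  · rw [← map_pow, cycGen_one_pow, AlgEquiv.commutes]

end Representation

theorem statement18 (k : Type*) [Field k] [IsAlgClosed k] [CharZero k]
    (θ₁ θ₂ : kˣ) (m₁ m₂ : ℕ) (hm₁ : 0 < m₁) (hm₂ : 0 < m₂)
    (hord₁ : orderOf θ₁ = m₁) (hord₂ : orderOf θ₂ = m₂)
    -- if the cyclic algebras `(t_1,t_2; m₁, K_2, θ₁)` and `(t_1,t_2; m₂, K_2, θ₂)`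
    -- are isomorphic as `K_2`-algebras ...
    (h : Nonempty ((CyclicAlg k m₁ (θ₁ : k) (tv k 0) (tv k 1)) ≃ₐ[KTwo k]
        (CyclicAlg k m₂ (θ₂ : k) (tv k 0) (tv k 1)))) :
    -- ... then `θ₁ = θ₂`
    θ₁ = θ₂ := by
  obtain ⟨e⟩ := h
  have h₁ : (θ₁ : k) ^ m₁ = 1 := by
    rw [← Units.val_pow_eq_pow_val, ← hord₁, pow_orderOf_eq_one, Units.val_one]
  have h₂ : (θ₂ : k) ^ m₂ = 1 := by
    rw [← Units.val_pow_eq_pow_val, ← hord₂, pow_orderOf_eq_one, Units.val_one]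
  obtain ⟨hdvd, himp⟩ := CyclicAlg.eq_of_algEquiv hm₂ hm₁ h₂ e
  exact Units.ext (himp (Nat.dvd_antisymm hdvd (CyclicAlg.eq_of_algEquiv hm₁ hm₂ h₁ e.symm).1))
end
end
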